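/- There exists an absolute constant c > 0 such that for every f ∈ L log L(𝕋²) and every λ > 0, the Lebesgue measure of the set {(x,y) ∈ 𝕋² : bmo[S_{nn}(x,y,f)] > λ} is at most (c/λ)·(1 + ∬_{𝕋²} |f| log⁺|f|). -/

import Mathlib

open MeasureTheory Filter Set

noncomputable section

/-- `[-π, π)`, a fundamental domain for the circle `𝕋 = ℝ/2πℤ`. -/
def T1 : Set ℝ := Set.Ico (-Real.pi) Real.pi

/-- `[-π, π)²`, a fundamental domain for the torus `𝕋²`. -/
def T2 : Set (ℝ × ℝ) := T1 ×ˢ T1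

/-- `log⁺ u = log u` for `u > 1`, and `0` otherwise. -/
def logPlus (u : ℝ) : ℝ := if 1 < u then Real.log u else 0

/-- `f` is `2π`-periodic in each variable. -/
def Biperiodic (f : ℝ × ℝ → ℝ) : Prop :=
  ∀ x y : ℝ, f (x + 2 * Real.pi, y) = f (x, y) ∧ f (x, y + 2 * Real.pi) = f (x, y)

/-- Fourier coefficients `f̂(m,n)` of a function on `𝕋²`. -/
def fourierCoef2 (f : ℝ × ℝ → ℝ) (m n : ℤ) : ℂ :=
  (1 / (4 * (Real.pi : ℂ) ^ 2)) *
    ∫ p in T2, (f p : ℂ) * Complex.exp (-Complex.I * ((m : ℂ) * (p.1 : ℂ) + (n : ℂ) * (p.2 : ℂ)))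

/-- Quadratic partial sums `S_{nn}(x, y, f)` of the double Fourier series.
(For real `f` the symmetric sum is real, so we take the real part.) -/
def Snn (f : ℝ × ℝ → ℝ) (n : ℕ) (x y : ℝ) : ℝ :=
  (∑ m ∈ Finset.Icc (-(n : ℤ)) (n : ℤ), ∑ k ∈ Finset.Icc (-(n : ℤ)) (n : ℤ),
    fourierCoef2 f m k * Complex.exp (Complex.I * ((m : ℂ) * (x : ℂ) + (k : ℂ) * (y : ℂ)))).re

/-- The `BMO[0,1]` norm:
`‖g‖_BMO = sup_{I ⊂ [0,1]} (1/|I|) ∫_I |g - g_I| + |∫_0^1 g|`. -/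
def bmoNorm (g : ℝ → ℝ) : ℝ :=
  (⨆ I : {p : ℝ × ℝ // 0 ≤ p.1 ∧ p.1 < p.2 ∧ p.2 ≤ 1},
      (I.1.2 - I.1.1)⁻¹ *
        ∫ t in Set.Icc I.1.1 I.1.2,
          |g t - (I.1.2 - I.1.1)⁻¹ * ∫ s in Set.Icc I.1.1 I.1.2, g s|) +
    |∫ t in Set.Icc (0 : ℝ) 1, g t|

/-- The step function `Σ_{k=0}^n ξ_k 𝟙_{δ_k^n}` with `δ_k^n = [k/(n+1), (k+1)/(n+1)]`. -/
def stepFun (ξ : ℕ → ℝ) (n : ℕ) (t : ℝ) : ℝ :=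
  ∑ k ∈ Finset.range (n + 1),
    Set.indicator (Set.Icc ((k : ℝ) / ((n : ℝ) + 1)) (((k : ℝ) + 1) / ((n : ℝ) + 1)))
      (fun _ => ξ k) t

/-- `bmo[ξ_n] = sup_{n ≥ 0} ‖Σ_{k=0}^n ξ_k 𝟙_{δ_k^n}‖_BMO`. -/
def bmoSeq (ξ : ℕ → ℝ) : ℝ := ⨆ n : ℕ, bmoNorm (stepFun ξ n)

/-- `L` is the principal value `p.v. ∫_𝕋 g`, i.e. the limit as `ε → 0⁺` of the
integrals over `{ε < |t| < π}`. -/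
def pvT1 (g : ℝ → ℝ) (L : ℝ) : Prop :=
  Filter.Tendsto (fun ε : ℝ => ∫ t in {t : ℝ | ε < |t| ∧ |t| < Real.pi}, g t)
    (nhdsWithin 0 (Set.Ioi 0)) (nhds L)

/-- `L` is the two-dimensional principal value `p.v. ∬_{𝕋²} g`, the limit as `ε → 0⁺`
of the integrals over `{ε < |t| < π, ε < |s| < π}`. -/
def pvT2 (g : ℝ × ℝ → ℝ) (L : ℝ) : Prop :=
  Filter.Tendsto
    (fun ε : ℝ =>
      ∫ q in {q : ℝ × ℝ | (ε < |q.1| ∧ |q.1| < Real.pi) ∧ ε < |q.2| ∧ |q.2| < Real.pi}, g q)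
    (nhdsWithin 0 (Set.Ioi 0)) (nhds L)

/-- Luxemburg norm with respect to a Young function `M`. -/
def luxNorm {α : Type*} [MeasurableSpace α] (μ : Measure α) (M : ℝ → ℝ) (g : α → ℝ) : ℝ :=
  sInf {lam : ℝ | 0 < lam ∧ ∫⁻ x, ENNReal.ofReal (M (|g x| / lam)) ∂μ ≤ 1}

/-- The Young function `Φ(t) = t log⁺ t`. -/
def PhiY (t : ℝ) : ℝ := t * logPlus t

/-- The Young function `Ψ(t) = eᵗ - 1`. -/
def PsiY (t : ℝ) : ℝ := Real.exp t - 1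

/-! ### Part 1: from discrete oscillation to the `bmoNorm` of step functions -/

/-- Discrete mean oscillation bound. -/
def OscLe (ξ : ℕ → ℝ) (A : ℝ) : Prop :=
  ∀ a N : ℕ, 0 < N → ∃ c : ℝ, ∑ k ∈ Finset.range N, |ξ (a + k) - c| ≤ A * N

lemma stepFun_eq (ξ : ℕ → ℝ) (n k : ℕ) (hk : k < n + 1) (t : ℝ)
    (h1 : (k : ℝ) < t * (n + 1)) (h2 : t * (n + 1) < k + 1) : stepFun ξ n t = ξ k := by
  have hM : (0 : ℝ) < n + 1 := by positivity
  unfold stepFun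
  rw [Finset.sum_eq_single k]
  · rw [Set.indicator_of_mem]
    constructor
    · rw [div_le_iff₀ hM]; exact h1.le
    · rw [le_div_iff₀ hM]; exact h2.le
  · intro j _ hj
    rw [Set.indicator_of_notMem]
    rintro ⟨h3, h4⟩
    rw [div_le_iff₀ hM] at h3
    rw [le_div_iff₀ hM] at h4
    apply hj
    have h5 : (j : ℝ) < k + 1 := by linarith
    have h6 : (k : ℝ) < j + 1 := by linarith
    have h5' : j < k + 1 := by exact_mod_cast h5
    have h6' : k < j + 1 := by exact_mod_cast h6
    omega
  · intro h; exact absurd (Finset.mem_range.2 hk) h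

lemma stepFun_integrable (ξ : ℕ → ℝ) (n : ℕ) (α β : ℝ) :
    IntegrableOn (stepFun ξ n) (Icc α β) := by
  unfold stepFun
  apply integrable_finsetSum
  intro k _
  apply Integrable.indicator _ measurableSet_Icc
  exact integrable_const _

lemma stepFun_osc_aux (ξ : ℕ → ℝ) (A : ℝ) (h : OscLe ξ A) (n : ℕ) (α β : ℝ)
    (h0 : 0 ≤ α) (hab : α < β) (h1 : β ≤ 1) :
    ∃ c : ℝ, ∫ t in Icc α β, |stepFun ξ n t - c| ≤ 3 * A * (β - α) := by
  have hM : (0 : ℝ) < n + 1 := by positivity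
  set M : ℝ := n + 1 with hMdef
  set a := ⌊α * M⌋₊ with ha
  set b := ⌈β * M⌉₊ with hb
  have ha1 : (a : ℝ) ≤ α * M := Nat.floor_le (by positivity)
  have ha2 : α * M < a + 1 := Nat.lt_floor_add_one _
  have hb1 : β * M ≤ b := Nat.le_ceil _
  have hb2 : (b : ℝ) < β * M + 1 := Nat.ceil_lt_add_one (by nlinarith)
  have hbM : b ≤ n + 1 := by
    apply Nat.ceil_le.2
    push_cast
    nlinarith
  have hlt : a < b := by
    have : (a : ℝ) < b := by nlinarith
    exact_mod_cast this
  obtain ⟨N, hN⟩ : ∃ N, b = a + N := ⟨b - a, by omega⟩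
  have hN0 : 0 < N := by omega
  obtain ⟨c, hc⟩ := h a N hN0
  have hNle : (N : ℝ) ≤ (β - α) * M + 2 := by
    have : (b : ℝ) = a + N := by exact_mod_cast hN
    nlinarith
  have hA0 : 0 ≤ A := by
    have : 0 ≤ A * N := le_trans (Finset.sum_nonneg fun _ _ => abs_nonneg _) hc
    have hN' : (0 : ℝ) < N := by exact_mod_cast hN0
    by_contra hneg
    push Not at hneg
    nlinarith
  refine ⟨c, ?_⟩
  set δ : ℕ → Set ℝ := fun k => Icc ((k : ℝ) / M) (((k : ℝ) + 1) / M) with hδ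
  have hbound : ∀ᵐ t ∂(volume.restrict (Icc α β)), |stepFun ξ n t - c| ≤
      ∑ k ∈ Finset.range N, (δ (a + k)).indicator (fun _ => |ξ (a + k) - c|) t := by
    have hnull : volume (Set.range (fun j : ℕ => (j : ℝ) / M)) = 0 :=
      (Set.countable_range _).measure_zero _
    have h1 : ∀ᵐ t ∂(volume.restrict (Icc α β)), t ∉ Set.range (fun j : ℕ => (j : ℝ) / M) :=
      ae_restrict_of_ae (measure_eq_zero_iff_ae_notMem.1 hnull)
    filter_upwards [h1, ae_restrict_mem measurableSet_Icc] with t ht htI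
    set k := ⌊t * M⌋₊ with hk
    have ht0 : 0 ≤ t := h0.trans htI.1
    have hk1 : (k : ℝ) ≤ t * M := Nat.floor_le (by positivity)
    have hk2 : t * M < k + 1 := Nat.lt_floor_add_one _
    have hk1' : (k : ℝ) < t * M := by
      refine lt_of_le_of_ne hk1 fun heq => ht ⟨k, ?_⟩
      simp only []
      rw [heq]; field_simp
    have hak : a ≤ k := Nat.floor_mono (by nlinarith [htI.1])
    have hkb : k < b := by
      have : (k : ℝ) < b := by nlinarith [htI.2]
      exact_mod_cast this
    obtain ⟨i, hi⟩ : ∃ i, k = a + i := ⟨k - a, by omega⟩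
    have hiN : i < N := by omega
    rw [stepFun_eq ξ n k (by omega) t hk1' hk2]
    have hmem : t ∈ δ (a + i) := by
      rw [← hi]
      exact ⟨by rw [div_le_iff₀ hM]; exact hk1, by rw [le_div_iff₀ hM]; exact hk2.le⟩
    calc |ξ k - c| = (δ (a + i)).indicator (fun _ => |ξ (a + i) - c|) t := by
          rw [Set.indicator_of_mem hmem, hi]
      _ ≤ _ := Finset.single_le_sum
          (f := fun k => (δ (a + k)).indicator (fun _ => |ξ (a + k) - c|) t)
          (fun j _ => Set.indicator_nonneg (fun _ _ => abs_nonneg _) _) (Finset.mem_range.2 hiN)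
  have hIntg : ∀ k ∈ Finset.range N, IntegrableOn
      ((δ (a + k)).indicator (fun _ => |ξ (a + k) - c|)) (Icc α β) := by
    intro k _
    apply Integrable.indicator _ measurableSet_Icc
    exact integrable_const _
  calc ∫ t in Icc α β, |stepFun ξ n t - c|
      ≤ ∫ t in Icc α β, ∑ k ∈ Finset.range N,
          (δ (a + k)).indicator (fun _ => |ξ (a + k) - c|) t := by
        apply integral_mono_ae _ _ hbound
        · exact ((stepFun_integrable ξ n α β).sub (integrable_const _)).abs
        · exact integrable_finsetSum _ hIntg
    _ = ∑ k ∈ Finset.range N, ∫ t in Icc α β,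
          (δ (a + k)).indicator (fun _ => |ξ (a + k) - c|) t := integral_finsetSum _ hIntg
    _ ≤ ∑ k ∈ Finset.range N, min (β - α) (1 / M) * |ξ (a + k) - c| := by
        apply Finset.sum_le_sum
        intro k _
        rw [setIntegral_indicator measurableSet_Icc, setIntegral_const, smul_eq_mul]
        apply mul_le_mul_of_nonneg_right _ (abs_nonneg _)
        apply le_min
        · calc volume.real (Icc α β ∩ δ (a + k)) ≤ volume.real (Icc α β) :=
              measureReal_mono Set.inter_subset_left (by simp)
            _ = β - α := by simp [hab.le]
        · calc volume.real (Icc α β ∩ δ (a + k)) ≤ volume.real (δ (a + k)) :=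
              measureReal_mono Set.inter_subset_right (by simp [hδ])
            _ = 1 / M := by
              simp only [hδ, Real.volume_real_Icc]
              rw [max_eq_left]
              · field_simp; ring
              · rw [← sub_div]; apply div_nonneg _ hM.le; linarith
    _ = min (β - α) (1 / M) * ∑ k ∈ Finset.range N, |ξ (a + k) - c| := by
        rw [Finset.mul_sum]
    _ ≤ min (β - α) (1 / M) * (A * N) := by
        apply mul_le_mul_of_nonneg_left hc
        apply le_min <;> [linarith; positivity]
    _ ≤ 3 * A * (β - α) := by
        have key : min (β - α) (1 / M) * N ≤ 3 * (β - α) := by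
          have hN' : (0 : ℝ) ≤ N := by positivity
          rcases le_total (1 / M) (β - α) with hle | hle
          · rw [min_eq_right hle]
            have : 1 / M * N ≤ 1 / M * ((β - α) * M + 2) := by gcongr
            have h3 : 1 / M * ((β - α) * M + 2) = (β - α) + 2 * (1 / M) := by field_simp
            linarith
          · rw [min_eq_left hle]
            have : (β - α) * M ≤ 1 := by
              rw [le_div_iff₀ hM] at hle; exact hle
            nlinarith
        nlinarith

lemma stepFun_osc (ξ : ℕ → ℝ) (A : ℝ) (h : OscLe ξ A) (n : ℕ) (α β : ℝ)
    (h0 : 0 ≤ α) (hab : α < β) (h1 : β ≤ 1) :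
    (β - α)⁻¹ * ∫ t in Icc α β, |stepFun ξ n t - (β - α)⁻¹ * ∫ s in Icc α β, stepFun ξ n s|
      ≤ 6 * A := by
  obtain ⟨c, hc⟩ := stepFun_osc_aux ξ A h n α β h0 hab h1
  have hL : 0 < β - α := by linarith
  set g := stepFun ξ n
  have hg : IntegrableOn g (Icc α β) := stepFun_integrable ξ n α β
  set m := (β - α)⁻¹ * ∫ s in Icc α β, g s with hm
  have hvol : ∀ d : ℝ, ∫ _ in Icc α β, d = (β - α) * d := by
    intro d
    rw [setIntegral_const, Real.volume_real_Icc_of_le hab.le, smul_eq_mul]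
  have hgc : IntegrableOn (fun t => g t - c) (Icc α β) := hg.sub (integrable_const _)
  have hmc : |c - m| ≤ (β - α)⁻¹ * ∫ t in Icc α β, |g t - c| := by
    have : m - c = (β - α)⁻¹ * ∫ t in Icc α β, (g t - c) := by
      rw [integral_sub hg (integrable_const _), hvol, hm]
      field_simp
    rw [abs_sub_comm, this, abs_mul, abs_of_pos (inv_pos.2 hL)]
    gcongr
    exact abs_integral_le_integral_abs
  have : ∫ t in Icc α β, |g t - m| ≤ ∫ t in Icc α β, (|g t - c| + |c - m|) := by
    apply integral_mono
    · exact (hg.sub (integrable_const _)).abs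
    · exact hgc.abs.add (integrable_const _)
    · intro t
      exact abs_sub_le _ _ _
  rw [integral_add hgc.abs (integrable_const _), hvol] at this
  have h2 : (β - α) * |c - m| ≤ ∫ t in Icc α β, |g t - c| := by
    calc _ ≤ (β - α) * ((β - α)⁻¹ * ∫ t in Icc α β, |g t - c|) := by gcongr
      _ = _ := by field_simp
  rw [inv_mul_le_iff₀ hL]
  linarith

lemma stepFun_integral (ξ : ℕ → ℝ) (n : ℕ) :
    ∫ t in Icc (0 : ℝ) 1, stepFun ξ n t
      = (∑ k ∈ Finset.range (n + 1), ξ k) / ((n : ℝ) + 1) := by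
  have hM : (0 : ℝ) < n + 1 := by positivity
  unfold stepFun
  rw [integral_finsetSum, Finset.sum_div]
  · apply Finset.sum_congr rfl
    intro k hk
    have hk' : (k : ℝ) + 1 ≤ n + 1 := by
      have := Finset.mem_range.1 hk
      exact_mod_cast this
    rw [setIntegral_indicator measurableSet_Icc, Set.inter_eq_self_of_subset_right,
      setIntegral_const, Real.volume_real_Icc_of_le, smul_eq_mul]
    · field_simp; ring
    · gcongr; linarith
    · apply Set.Icc_subset_Icc
      · positivity
      · rw [div_le_one hM]; exact hk'
  · intro k _
    apply Integrable.indicator _ measurableSet_Icc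
    exact integrable_const _

lemma bmoNorm_stepFun_le (ξ : ℕ → ℝ) (A B : ℝ) (h : OscLe ξ A) (n : ℕ)
    (hB : |(∑ k ∈ Finset.range (n + 1), ξ k) / ((n : ℝ) + 1)| ≤ B) :
    bmoNorm (stepFun ξ n) ≤ 6 * A + B := by
  unfold bmoNorm
  rw [stepFun_integral]
  apply add_le_add _ hB
  have : Nonempty {p : ℝ × ℝ // 0 ≤ p.1 ∧ p.1 < p.2 ∧ p.2 ≤ 1} := ⟨⟨(0, 1), by norm_num⟩⟩
  apply ciSup_le
  rintro ⟨⟨α, β⟩, h0, hab, h1⟩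
  exact stepFun_osc ξ A h n α β h0 hab h1

/-! ### Part 2: Abel means versus arithmetic means -/

lemma abel_mean_aux (ξ : ℕ → ℝ) (A : ℝ) (h : OscLe ξ A) (L : ℕ) (hL : 0 < L) (i : ℕ) :
    ∑ k ∈ Finset.range L, |ξ (i * L + k) - (∑ k ∈ Finset.range L, ξ k) / L|
      ≤ 2 * ((i : ℝ) + 1) * L * A := by
  obtain ⟨c, hc⟩ := h 0 ((i + 1) * L) (by positivity)
  simp only [zero_add] at hc
  push_cast at hc
  have hL' : (0 : ℝ) < L := by exact_mod_cast hL
  set m := (∑ k ∈ Finset.range L, ξ k) / L with hm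
  have h1 : ∑ k ∈ Finset.range L, |ξ (i * L + k) - c| ≤ A * (((i : ℝ) + 1) * L) := by
    refine le_trans ?_ hc
    rw [show (i + 1) * L = i * L + L by ring, Finset.sum_range_add]
    have : 0 ≤ ∑ k ∈ Finset.range (i * L), |ξ k - c| := Finset.sum_nonneg fun _ _ => abs_nonneg _
    linarith
  have h2 : ∑ k ∈ Finset.range L, |ξ k - c| ≤ A * (((i : ℝ) + 1) * L) := by
    refine le_trans ?_ hc
    apply Finset.sum_le_sum_of_subset_of_nonneg
    · intro k hk
      have := Finset.mem_range.1 hk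
      apply Finset.mem_range.2
      nlinarith
    · intros; exact abs_nonneg _
  have h3 : L * |c - m| ≤ ∑ k ∈ Finset.range L, |ξ k - c| := by
    have : (L : ℝ) * (m - c) = ∑ k ∈ Finset.range L, (ξ k - c) := by
      rw [Finset.sum_sub_distrib, Finset.sum_const, Finset.card_range, nsmul_eq_mul, hm]
      field_simp
    calc (L : ℝ) * |c - m| = |(L : ℝ) * (m - c)| := by
          rw [abs_mul, abs_of_pos hL', abs_sub_comm]
      _ ≤ _ := by rw [this]; exact Finset.abs_sum_le_sum_abs _ _
  calc ∑ k ∈ Finset.range L, |ξ (i * L + k) - m|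
      ≤ ∑ k ∈ Finset.range L, (|ξ (i * L + k) - c| + |c - m|) :=
        Finset.sum_le_sum fun k _ => abs_sub_le _ _ _
    _ = ∑ k ∈ Finset.range L, |ξ (i * L + k) - c| + L * |c - m| := by
        rw [Finset.sum_add_distrib, Finset.sum_const, Finset.card_range, nsmul_eq_mul]
    _ ≤ _ := by linarith

lemma sum_blocks (b : ℕ → ℝ) (L I : ℕ) :
    ∑ k ∈ Finset.range (I * L), b k
      = ∑ i ∈ Finset.range I, ∑ k ∈ Finset.range L, b (i * L + k) := by
  induction I with
  | zero => simp
  | succ I ih => rw [show (I + 1) * L = I * L + L by ring, Finset.sum_range_add, ih,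
      Finset.sum_range_succ]

/-- Abel means at the scale `L` are comparable to arithmetic means. -/
lemma abel_mean (ξ : ℕ → ℝ) (A : ℝ) (h : OscLe ξ A) (L : ℕ) (hL : 0 < L) (q : ℝ)
    (hq0 : 0 < q) (hq1 : q < 1) (hqL : q ^ L ≤ 1 / 2) (hq : (1 - q) * L ≤ 4) (a : ℝ)
    (ha : HasSum (fun k => (1 - q) * q ^ k * ξ k) a) :
    |(∑ k ∈ Finset.range L, ξ k) / L| ≤ |a| + 32 * A := by
  set m := (∑ k ∈ Finset.range L, ξ k) / L with hm
  have hL' : (0 : ℝ) < L := by exact_mod_cast hL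
  have hA0 : 0 ≤ A := by
    obtain ⟨c, hc⟩ := h 0 1 one_pos
    have : 0 ≤ ∑ k ∈ Finset.range 1, |ξ (0 + k) - c| := Finset.sum_nonneg fun _ _ => abs_nonneg _
    simp only [Nat.cast_one, mul_one] at hc
    linarith
  have hgeo : HasSum (fun k => (1 - q) * q ^ k * m) m := by
    have := ((hasSum_geometric_of_lt_one hq0.le hq1).mul_left (1 - q)).mul_right m
    rwa [mul_inv_cancel₀ (by linarith), one_mul] at this
  have hdiff := ha.sub hgeo
  have hdiff' : HasSum (fun k => (1 - q) * q ^ k * (ξ k - m)) (a - m) := by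
    have e : (fun k => (1 - q) * q ^ k * (ξ k - m))
        = fun k => (1 - q) * q ^ k * ξ k - (1 - q) * q ^ k * m := by
      funext k; ring
    rw [e]; exact hdiff
  have htend : Tendsto (fun I => ∑ k ∈ Finset.range (I * L), (1 - q) * q ^ k * (ξ k - m)) atTop
      (nhds (a - m)) :=
    hdiff'.tendsto_sum_nat.comp (tendsto_id.atTop_mul_const' hL)
  have hb : ∀ I : ℕ, |∑ k ∈ Finset.range (I * L), (1 - q) * q ^ k * (ξ k - m)| ≤ 32 * A := by
    intro I
    rw [sum_blocks]
    have hgeo2 : HasSum (fun n : ℕ => ((n : ℝ) + 1) * (1 / 2 : ℝ) ^ n) 4 := by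
      have h1 := hasSum_coe_mul_geometric_of_norm_lt_one (𝕜 := ℝ) (r := 1 / 2) (by norm_num)
      have h2 := hasSum_geometric_of_lt_one (r := (1 / 2 : ℝ)) (by norm_num) (by norm_num)
      have := h1.add h2
      have e : (fun n : ℕ => ((n : ℝ) + 1) * (1 / 2 : ℝ) ^ n)
          = fun n : ℕ => (n : ℝ) * (1 / 2 : ℝ) ^ n + (1 / 2 : ℝ) ^ n := by
        funext k; ring
      have e2 : (4 : ℝ) = 1 / 2 / (1 - 1 / 2) ^ 2 + (1 - 1 / 2)⁻¹ := by norm_num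
      rw [e, e2]; exact this
    calc |∑ i ∈ Finset.range I, ∑ k ∈ Finset.range L,
            (1 - q) * q ^ (i * L + k) * (ξ (i * L + k) - m)|
        ≤ ∑ i ∈ Finset.range I, ∑ k ∈ Finset.range L,
            |(1 - q) * q ^ (i * L + k) * (ξ (i * L + k) - m)| :=
          (Finset.abs_sum_le_sum_abs _ _).trans
            (Finset.sum_le_sum fun i _ => Finset.abs_sum_le_sum_abs _ _)
      _ ≤ ∑ i ∈ Finset.range I, ∑ k ∈ Finset.range L,
            (1 - q) * (1 / 2) ^ i * |ξ (i * L + k) - m| := by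
          apply Finset.sum_le_sum; intro i _
          apply Finset.sum_le_sum; intro k _
          rw [abs_mul, abs_of_nonneg (mul_nonneg (by linarith) (by positivity))]
          apply mul_le_mul_of_nonneg_right _ (abs_nonneg _)
          apply mul_le_mul_of_nonneg_left _ (by linarith)
          rw [pow_add, mul_comm i L, pow_mul]
          calc (q ^ L) ^ i * q ^ k ≤ (1 / 2) ^ i * 1 := by
                gcongr
                exact pow_le_one₀ hq0.le hq1.le
            _ = _ := mul_one _
      _ = ∑ i ∈ Finset.range I, (1 - q) * (1 / 2) ^ i *
            ∑ k ∈ Finset.range L, |ξ (i * L + k) - m| := by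
          simp only [Finset.mul_sum]
      _ ≤ ∑ i ∈ Finset.range I, (1 - q) * (1 / 2) ^ i * (2 * ((i : ℝ) + 1) * L * A) := by
          apply Finset.sum_le_sum; intro i _
          apply mul_le_mul_of_nonneg_left (abel_mean_aux ξ A h L hL i)
          exact mul_nonneg (by linarith) (by positivity)
      _ = ((1 - q) * L) * (2 * A) * ∑ i ∈ Finset.range I, ((i : ℝ) + 1) * (1 / 2) ^ i := by
          rw [Finset.mul_sum]
          apply Finset.sum_congr rfl; intro i _; ring
      _ ≤ 4 * (2 * A) * 4 := by
          gcongr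
          exact sum_le_hasSum _ (fun i _ => by positivity) hgeo2
      _ = _ := by ring
  have h1 : |a - m| ≤ 32 * A := le_of_tendsto htend.abs (Eventually.of_forall hb)
  have h2 : |m| ≤ |a| + |a - m| := by
    have := abs_sub_abs_le_abs_sub m a
    rw [abs_sub_comm m a] at this
    linarith
  linarith


/-! ### Part 3: a weak type estimate on the circle -/

instance factTwoPi : Fact (0 < 2 * Real.pi) := ⟨Real.two_pi_pos⟩

/-- The circle. -/
abbrev TT := AddCircle (2 * Real.pi)

/-- Normalized Haar measure on the circle. -/
abbrev mu : Measure TT := AddCircle.haarAddCircle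

lemma mu_closedBall_le (x : TT) (r : ℝ) : mu (Metric.closedBall x r) ≤ ENNReal.ofReal r := by
  have h := AddCircle.volume_closedBall (T := 2 * Real.pi) (x := x) r
  rw [AddCircle.volume_eq_smul_haarAddCircle, Measure.smul_apply, smul_eq_mul] at h
  have h2 : ENNReal.ofReal (2 * Real.pi) * mu (Metric.closedBall x r)
      ≤ ENNReal.ofReal (2 * Real.pi) * ENNReal.ofReal r := by
    rw [h, ← ENNReal.ofReal_mul (by positivity)]
    apply le_trans (ENNReal.ofReal_le_ofReal (min_le_right _ _))
    rcases le_total 0 r with hr | hr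
    · apply ENNReal.ofReal_le_ofReal
      nlinarith [Real.pi_gt_three]
    · rw [ENNReal.ofReal_of_nonpos (by linarith)]; exact zero_le
  rwa [ENNReal.mul_le_mul_iff_right (by simp [Real.pi_pos]) ENNReal.ofReal_ne_top] at h2

/-- The set where the maximal function exceeds `lam`. -/
def MaxSet (v : TT → ENNReal) (lam : ℝ) : Set TT :=
  {x | ∃ r : ℝ, 0 < r ∧ ENNReal.ofReal (lam * r) < ∫⁻ z in Metric.closedBall x r, v z ∂mu}

lemma mu_MaxSet_le (v : TT → ENNReal) (lam : ℝ) (hlam : 0 < lam)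
    (hfin : ∫⁻ z, v z ∂mu ≠ ⊤) :
    mu (MaxSet v lam) ≤ ENNReal.ofReal (5 / lam) * ∫⁻ z, v z ∂mu := by
  classical
  have hch : ∀ x ∈ MaxSet v lam, ∃ r : ℝ, 0 < r ∧
    ENNReal.ofReal (lam * r) < ∫⁻ z in Metric.closedBall x r, v z ∂mu := fun x hx => hx
  choose! r hr0 hr using hch
  have hR : ∀ x ∈ MaxSet v lam, r x ≤ (∫⁻ z, v z ∂mu).toReal / lam := by
    intro x hx
    rw [le_div_iff₀ hlam, mul_comm]
    have h1 : ENNReal.ofReal (lam * r x) ≤ ∫⁻ z, v z ∂mu :=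
      (hr x hx).le.trans (setLIntegral_le_lintegral _ _)
    exact (ENNReal.ofReal_le_iff_le_toReal hfin).1 h1
  obtain ⟨u, hu, hdisj, hcov⟩ := Vitali.exists_disjoint_subfamily_covering_enlargement_closedBall
    (MaxSet v lam) (fun x => x) r _ hR 5 (by norm_num)
  have hcount : u.Countable := by
    apply hdisj.countable_of_nonempty_interior
    intro x hx
    refine ⟨x, ?_⟩
    apply Metric.ball_subset_interior_closedBall
    exact Metric.mem_ball_self (hr0 x (hu hx))
  have hsub : MaxSet v lam ⊆ ⋃ b ∈ u, Metric.closedBall b (5 * r b) := by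
    intro x hx
    obtain ⟨b, hb, hb2⟩ := hcov x hx
    exact Set.mem_biUnion hb (hb2 (Metric.mem_closedBall_self (hr0 x hx).le))
  calc mu (MaxSet v lam) ≤ mu (⋃ b ∈ u, Metric.closedBall b (5 * r b)) := measure_mono hsub
    _ ≤ ∑' b : u, mu (Metric.closedBall (b : TT) (5 * r b)) := measure_biUnion_le _ hcount _
    _ ≤ ∑' b : u, ENNReal.ofReal (5 / lam) * ∫⁻ z in Metric.closedBall (b : TT) (r b), v z ∂mu := by
        apply ENNReal.tsum_le_tsum
        intro b
        apply (mu_closedBall_le _ _).trans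
        calc ENNReal.ofReal (5 * r b) = ENNReal.ofReal (5 / lam) * ENNReal.ofReal (lam * r b) := by
              rw [← ENNReal.ofReal_mul (by positivity)]; congr 1; field_simp
          _ ≤ _ := by
              gcongr
              exact (hr b (hu b.2)).le
    _ = ENNReal.ofReal (5 / lam) * ∑' b : u, ∫⁻ z in Metric.closedBall (b : TT) (r b), v z ∂mu :=
        ENNReal.tsum_mul_left
    _ = ENNReal.ofReal (5 / lam) * ∫⁻ z in ⋃ b ∈ u, Metric.closedBall b (r b), v z ∂mu := by
        rw [lintegral_biUnion hcount (fun b _ => Metric.isClosed_closedBall.measurableSet) hdisj]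
    _ ≤ _ := by
        gcongr
        exact Measure.restrict_le_self

lemma kernel_dyadic (ρ s : ℝ) (hρ : 0 < ρ) (hs : 0 ≤ s) :
    ∃ i : ℕ, s ≤ 2 ^ i * ρ ∧ ρ / (ρ ^ 2 + s ^ 2) ≤ 4 / (4 ^ i * ρ) := by
  have hex : ∃ i : ℕ, s ≤ 2 ^ i * ρ := by
    obtain ⟨i, hi⟩ := pow_unbounded_of_one_lt (s / ρ) (one_lt_two)
    exact ⟨i, by rw [div_lt_iff₀ hρ] at hi; exact hi.le⟩
  classical
  refine ⟨Nat.find hex, Nat.find_spec hex, ?_⟩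
  rw [div_le_div_iff₀ (by positivity) (by positivity)]
  rcases Nat.eq_zero_or_pos (Nat.find hex) with h0 | hpos
  · rw [h0]; nlinarith [sq_nonneg s]
  · obtain ⟨j, hj⟩ := Nat.exists_eq_succ_of_ne_zero hpos.ne'
    have hmin : ¬ s ≤ 2 ^ j * ρ := Nat.find_min hex (by omega)
    push Not at hmin
    rw [hj]
    have h4 : (4 : ℝ) ^ j = (2 ^ j) ^ 2 := by rw [← pow_mul, mul_comm, pow_mul]; norm_num
    have : (2 ^ j * ρ) ^ 2 ≤ s ^ 2 := by
      apply pow_le_pow_left₀ (by positivity) hmin.le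
    rw [pow_succ, h4]
    nlinarith

/-- The Poisson type integral is controlled by ball averages. -/
lemma poisson_le (v : TT → ENNReal) (hv : Measurable v) (lam : ℝ) (hlam : 0 < lam) (p : TT)
    (hp : ∀ r : ℝ, 0 < r → ∫⁻ z in Metric.closedBall p r, v z ∂mu ≤ ENNReal.ofReal (lam * r))
    (ρ : ℝ) (hρ : 0 < ρ) :
    ∫⁻ z, v z * ENNReal.ofReal (ρ / (ρ ^ 2 + dist z p ^ 2)) ∂mu ≤ ENNReal.ofReal (8 * lam) := by
  calc ∫⁻ z, v z * ENNReal.ofReal (ρ / (ρ ^ 2 + dist z p ^ 2)) ∂mu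
      ≤ ∫⁻ z, ∑' i : ℕ, ENNReal.ofReal (4 / (4 ^ i * ρ)) *
          (Metric.closedBall p (2 ^ i * ρ)).indicator v z ∂mu := by
        apply lintegral_mono
        intro z
        obtain ⟨i, hi1, hi2⟩ := kernel_dyadic ρ (dist z p) hρ dist_nonneg
        refine le_trans ?_ (ENNReal.le_tsum i)
        rw [Set.indicator_of_mem (show z ∈ Metric.closedBall p (2 ^ i * ρ) from hi1)]
        calc v z * ENNReal.ofReal (ρ / (ρ ^ 2 + dist z p ^ 2))
            ≤ v z * ENNReal.ofReal (4 / (4 ^ i * ρ)) := by gcongr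
          _ = _ := mul_comm (v z) _
    _ = ∑' i : ℕ, ∫⁻ z, ENNReal.ofReal (4 / (4 ^ i * ρ)) *
          (Metric.closedBall p (2 ^ i * ρ)).indicator v z ∂mu := by
        apply lintegral_tsum
        intro i
        exact ((hv.indicator Metric.isClosed_closedBall.measurableSet).const_mul _).aemeasurable
    _ ≤ ∑' i : ℕ, ENNReal.ofReal (4 * lam * (1 / 2) ^ i) := by
        apply ENNReal.tsum_le_tsum
        intro i
        rw [lintegral_const_mul _ (hv.indicator Metric.isClosed_closedBall.measurableSet),
          lintegral_indicator Metric.isClosed_closedBall.measurableSet]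
        calc _ ≤ ENNReal.ofReal (4 / (4 ^ i * ρ)) * ENNReal.ofReal (lam * (2 ^ i * ρ)) := by
              gcongr; exact hp _ (by positivity)
          _ = _ := by
              rw [← ENNReal.ofReal_mul (by positivity)]
              congr 1
              have h4 : (4 : ℝ) ^ i = 2 ^ i * 2 ^ i := by rw [← mul_pow]; norm_num
              rw [h4, one_div, inv_pow]
              field_simp
    _ = ENNReal.ofReal (8 * lam) := by
        have hs := (hasSum_geometric_two).mul_left (4 * lam)
        rw [← ENNReal.ofReal_tsum_of_nonneg (fun i => by positivity) hs.summable, hs.tsum_eq]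
        congr 1; ring

/-- The Marcinkiewicz type integral. -/
def Jint (v : TT → ENNReal) (S : Set TT) (x : TT) : ENNReal :=
  ∫⁻ z, v z * ENNReal.ofReal (Metric.infDist z S / (Metric.infDist z S ^ 2 + dist z x ^ 2)) ∂mu

lemma Jint_meas (v : TT → ENNReal) (hv : Measurable v) (S : Set TT) :
    Measurable (fun q : TT × TT => v q.1 *
      ENNReal.ofReal (Metric.infDist q.1 S / (Metric.infDist q.1 S ^ 2 + dist q.1 q.2 ^ 2))) := by
  have h1 : Measurable fun q : TT × TT => Metric.infDist q.1 S :=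
    ((Metric.continuous_infDist_pt S).comp continuous_fst).measurable
  have h2 : Measurable fun q : TT × TT => dist q.1 q.2 := continuous_dist.measurable
  exact (hv.comp measurable_fst).mul
    (ENNReal.measurable_ofReal.comp (h1.div ((h1.pow_const 2).add (h2.pow_const 2))))

lemma Jint_measurable (v : TT → ENNReal) (hv : Measurable v) (S : Set TT) :
    Measurable (Jint v S) :=
  Measurable.lintegral_prod_left' (Jint_meas v hv S)

lemma lintegral_Jint (v : TT → ENNReal) (hv : Measurable v) (S : Set TT) :
    ∫⁻ x, Jint v S x ∂mu ≤ 8 * ∫⁻ z, v z ∂mu := by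
  unfold Jint
  have hm := Jint_meas v hv S
  rw [lintegral_lintegral_swap (f := fun x z => v z *
      ENNReal.ofReal (Metric.infDist z S / (Metric.infDist z S ^ 2 + dist z x ^ 2)))
      (hm.comp measurable_swap).aemeasurable, ← lintegral_const_mul _ hv]
  apply lintegral_mono
  intro z
  simp only []
  have hmz : Measurable fun x : TT =>
      ENNReal.ofReal (Metric.infDist z S / (Metric.infDist z S ^ 2 + dist z x ^ 2)) := by
    have h2 : Measurable fun x : TT => dist z x := (continuous_const.dist continuous_id).measurable
    exact ENNReal.measurable_ofReal.comp (measurable_const.div (measurable_const.add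
      (h2.pow_const 2)))
  rw [lintegral_const_mul _ hmz]
  suffices hs : ∫⁻ x, ENNReal.ofReal (Metric.infDist z S /
      (Metric.infDist z S ^ 2 + dist z x ^ 2)) ∂mu ≤ 8 by
    calc _ ≤ v z * 8 := by gcongr
      _ = _ := mul_comm (v z) _
  rcases (Metric.infDist_nonneg (x := z) (s := S)).eq_or_lt with h0 | hpos
  · rw [← h0]; simp
  · have := poisson_le (fun _ => 1) measurable_const 1 one_pos z
      (fun r _ => by simpa using mu_closedBall_le z r) _ hpos
    simp only [one_mul, dist_comm _ z] at this
    simpa using this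

/-- The exceptional set. -/
def ExcSet (v : TT → ENNReal) (lam : ℝ) : Set TT :=
  MaxSet v lam ∪ {x | ENNReal.ofReal lam < Jint v (MaxSet v lam)ᶜ x}

lemma mu_ExcSet_le (v : TT → ENNReal) (hv : Measurable v) (lam : ℝ) (hlam : 0 < lam)
    (hfin : ∫⁻ z, v z ∂mu ≠ ⊤) :
    mu (ExcSet v lam) ≤ ENNReal.ofReal (13 / lam) * ∫⁻ z, v z ∂mu := by
  have h1 := mu_MaxSet_le v lam hlam hfin
  have h2 : mu {x | ENNReal.ofReal lam < Jint v (MaxSet v lam)ᶜ x}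
      ≤ ENNReal.ofReal (8 / lam) * ∫⁻ z, v z ∂mu := by
    generalize (MaxSet v lam)ᶜ = S
    calc mu {x | ENNReal.ofReal lam < Jint v S x} ≤ mu {x | ENNReal.ofReal lam ≤ Jint v S x} :=
          measure_mono (Set.ofPred_subset_ofPred.2 fun x hx => le_of_lt hx)
      _ ≤ (∫⁻ x, Jint v S x ∂mu) / ENNReal.ofReal lam := by
          refine meas_ge_le_lintegral_div (Jint_measurable v hv S).aemeasurable ?_
            ENNReal.ofReal_ne_top
          simpa using hlam
      _ ≤ (8 * ∫⁻ z, v z ∂mu) / ENNReal.ofReal lam := by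
          gcongr; exact lintegral_Jint v hv _
      _ = _ := by
          rw [ENNReal.ofReal_div_of_pos hlam, ENNReal.div_eq_inv_mul, ENNReal.div_eq_inv_mul]
          rw [ENNReal.ofReal_ofNat, mul_assoc]
  calc _ ≤ _ := measure_union_le _ _
    _ ≤ ENNReal.ofReal (5 / lam) * ∫⁻ z, v z ∂mu + ENNReal.ofReal (8 / lam) * ∫⁻ z, v z ∂mu :=
        add_le_add h1 h2
    _ = _ := by
        rw [← add_mul, ← ENNReal.ofReal_add (by positivity) (by positivity)]
        congr 2; ring

lemma inner_bound (v : TT → ENNReal) (hv : Measurable v) (lam : ℝ) (hlam : 0 < lam)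
    (x : TT) (hx : x ∉ MaxSet v lam) (ε : ℝ) (hε : 0 < ε) (z : TT) :
    ∫⁻ w, v w * ENNReal.ofReal (ε ^ 2 / (ε ^ 2 + dist z w ^ 2)) ∂mu
      ≤ ENNReal.ofReal (72 * lam * (ε + Metric.infDist z (MaxSet v lam)ᶜ)) := by
  set S := (MaxSet v lam)ᶜ with hS
  have hne : S.Nonempty := ⟨x, hx⟩
  set d := Metric.infDist z S with hd
  have hd0 : 0 ≤ d := Metric.infDist_nonneg
  obtain ⟨p, hpS, hp⟩ := (Metric.infDist_lt_iff hne).1 (show Metric.infDist z S < d + ε by linarith)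
  set ρ := ε + d with hρ
  have hρ0 : 0 < ρ := by linarith
  have hpB : ∀ r : ℝ, 0 < r →
      ∫⁻ z in Metric.closedBall p r, v z ∂mu ≤ ENNReal.ofReal (lam * r) := by
    intro r hr
    by_contra hcon
    push Not at hcon
    exact hpS ⟨r, hr, hcon⟩
  have hP := poisson_le v hv lam hlam p hpB ρ hρ0
  calc ∫⁻ w, v w * ENNReal.ofReal (ε ^ 2 / (ε ^ 2 + dist z w ^ 2)) ∂mu
      ≤ ∫⁻ w, ENNReal.ofReal (9 * ρ) *
          (v w * ENNReal.ofReal (ρ / (ρ ^ 2 + dist w p ^ 2))) ∂mu := by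
        apply lintegral_mono
        intro w
        simp only []
        rw [mul_left_comm]
        gcongr
        rw [← ENNReal.ofReal_mul (by positivity)]
        apply ENNReal.ofReal_le_ofReal
        set D := dist z w with hD
        have hD0 : 0 ≤ D := dist_nonneg
        have hwp : dist w p ≤ D + ρ := by
          calc dist w p ≤ dist w z + dist z p := dist_triangle _ _ _
            _ ≤ D + ρ := by rw [dist_comm w z]; linarith
        have h1 : dist w p ^ 2 ≤ 2 * D ^ 2 + 2 * ρ ^ 2 := by
          have := pow_le_pow_left₀ dist_nonneg hwp 2
          nlinarith [sq_nonneg (D - ρ)]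
        rw [show 9 * ρ * (ρ / (ρ ^ 2 + dist w p ^ 2)) = 9 * ρ ^ 2 / (ρ ^ 2 + dist w p ^ 2) by ring]
        rw [div_le_div_iff₀ (by positivity) (by positivity)]
        have h2 : ε ^ 2 ≤ ρ ^ 2 := by
          apply pow_le_pow_left₀ hε.le; linarith
        have h3 : 0 ≤ (ρ ^ 2 - ε ^ 2) * D ^ 2 := mul_nonneg (by linarith) (sq_nonneg _)
        have h4 : ε ^ 2 * dist w p ^ 2 ≤ ε ^ 2 * (2 * D ^ 2 + 2 * ρ ^ 2) := by gcongr
        nlinarith [mul_nonneg (sq_nonneg ε) (sq_nonneg ρ), mul_nonneg (sq_nonneg D) (sq_nonneg ρ)]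
    _ ≤ ENNReal.ofReal (9 * ρ) * ENNReal.ofReal (8 * lam) := by
        rw [lintegral_const_mul']
        · gcongr
        · exact ENNReal.ofReal_ne_top
    _ = _ := by
        rw [← ENNReal.ofReal_mul (by positivity)]
        congr 1; ring

/-- Truncated reciprocal distance. -/
def recip (x : TT) (ε : ℝ) (z : TT) : ENNReal :=
  if ε < dist z x then ENNReal.ofReal (1 / dist z x) else 0

lemma recip_meas (x : TT) (ε : ℝ) : Measurable (recip x ε) := by
  have h : Measurable fun z : TT => dist z x := (continuous_id.dist continuous_const).measurable
  unfold recip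
  apply Measurable.ite
  · exact measurableSet_lt measurable_const h
  · exact ENNReal.measurable_ofReal.comp (measurable_const.div h)
  · exact measurable_const

set_option maxHeartbeats 1000000 in
lemma quad_bound (v : TT → ENNReal) (hv : Measurable v) (lam : ℝ) (hlam : 0 < lam)
    (x : TT) (hx : x ∉ ExcSet v lam) (ε : ℝ) (hε : 0 < ε) :
    ∫⁻ z, ∫⁻ w, (v z * recip x ε z) * (v w * recip x ε w) *
        ENNReal.ofReal (ε ^ 2 / (ε ^ 2 + dist z w ^ 2)) ∂mu ∂mu
      ≤ ENNReal.ofReal (1296 * lam ^ 2) := by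
  have hx1 : x ∉ MaxSet v lam := fun h => hx (Or.inl h)
  have hx2 : Jint v (MaxSet v lam)ᶜ x ≤ ENNReal.ofReal lam := by
    by_contra hcon
    push Not at hcon
    exact hx (Or.inr hcon)
  set S := (MaxSet v lam)ᶜ with hS
  set k : TT → TT → ENNReal := fun z w => ENNReal.ofReal (ε ^ 2 / (ε ^ 2 + dist z w ^ 2)) with hk
  set a : TT → ENNReal := recip x ε with ha
  have ham : Measurable a := recip_meas x ε
  have hkm : Measurable (fun q : TT × TT => k q.1 q.2) := by
    have h2 : Measurable fun q : TT × TT => dist q.1 q.2 := continuous_dist.measurable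
    exact ENNReal.measurable_ofReal.comp (measurable_const.div (measurable_const.add
      (h2.pow_const 2)))
  have hksymm : ∀ z w, k z w = k w z := by
    intro z w; simp only [hk, dist_comm]
  set Q := ∫⁻ z, ∫⁻ w, (v z * a z) * (v w * a w) * k z w ∂mu ∂mu with hQ
  set R := ∫⁻ z, ∫⁻ w, v z * a z ^ 2 * (v w * k z w) ∂mu ∂mu with hR
  have hm1 : Measurable (fun q : TT × TT => v q.1 * a q.1 ^ 2 * (v q.2 * k q.1 q.2)) :=
    ((hv.comp measurable_fst).mul ((ham.comp measurable_fst).pow_const 2)).mul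
      ((hv.comp measurable_snd).mul hkm)
  have hR' : R = ∫⁻ z, ∫⁻ w, v w * a w ^ 2 * (v z * k z w) ∂mu ∂mu := by
    rw [hR, lintegral_lintegral_swap (f := fun z w => v z * a z ^ 2 * (v w * k z w))
      hm1.aemeasurable]
    simp only [hksymm]
  have hm2 : Measurable (fun q : TT × TT => v q.2 * a q.2 ^ 2 * (v q.1 * k q.1 q.2)) :=
    ((hv.comp measurable_snd).mul ((ham.comp measurable_snd).pow_const 2)).mul
      ((hv.comp measurable_fst).mul hkm)
  have h2Q : 2 * Q ≤ R + R := by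
    calc 2 * Q = ∫⁻ z, 2 * ∫⁻ w, (v z * a z) * (v w * a w) * k z w ∂mu ∂mu := by
          rw [lintegral_const_mul' _ _ (by simp)]
      _ = ∫⁻ z, ∫⁻ w, 2 * ((v z * a z) * (v w * a w) * k z w) ∂mu ∂mu := by
          congr 1; ext z; rw [lintegral_const_mul' _ _ (by simp)]
      _ ≤ ∫⁻ z, ∫⁻ w, (v z * a z ^ 2 * (v w * k z w) + v w * a w ^ 2 * (v z * k z w)) ∂mu ∂mu := by
          apply lintegral_mono; intro z
          apply lintegral_mono; intro w
          have h : 2 * (a z * a w) ≤ a z ^ 2 + a w ^ 2 := by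
            have hz : a z ≠ ⊤ := by
              simp only [ha, recip]; split_ifs <;> simp
            have hw : a w ≠ ⊤ := by
              simp only [ha, recip]; split_ifs <;> simp
            lift a z to NNReal using hz with p
            lift a w to NNReal using hw with q
            norm_cast
            have := two_mul_le_add_sq (p : ℝ) (q : ℝ)
            rw [← NNReal.coe_le_coe]; push_cast; linarith
          calc 2 * ((v z * a z) * (v w * a w) * k z w) = (2 * (a z * a w)) * (v z * v w * k z w) := by
                ring
            _ ≤ (a z ^ 2 + a w ^ 2) * (v z * v w * k z w) := by gcongr
            _ = _ := by ring
      _ = R + R := by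
          nth_rewrite 2 [hR']
          rw [hR, ← lintegral_add_left]
          · congr 1; ext z
            rw [lintegral_add_left]
            exact hm1.comp measurable_prodMk_left
          · exact Measurable.lintegral_prod_right' hm1
  have hQR : Q ≤ R := by
    rw [two_mul] at h2Q
    by_contra hcon
    push Not at hcon
    exact absurd h2Q (not_le.2 (ENNReal.add_lt_add hcon hcon))
  refine hQR.trans ?_
  have hxP := poisson_le v hv lam hlam x (by
    intro r hr
    by_contra hcon
    push Not at hcon
    exact hx1 ⟨r, hr, hcon⟩) ε hε
  calc R ≤ ∫⁻ z, v z * a z ^ 2 * ENNReal.ofReal (72 * lam * (ε + Metric.infDist z S)) ∂mu := by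
        apply lintegral_mono; intro z
        simp only []
        have hkz : Measurable (k z) := Measurable.of_uncurry_left (f := k) hkm
        have hmk : Measurable fun w => v w * k z w := hv.mul hkz
        rw [lintegral_const_mul _ hmk]
        gcongr
        exact inner_bound v hv lam hlam x hx1 ε hε z
    _ ≤ ∫⁻ z, ENNReal.ofReal (144 * lam) * (v z * ENNReal.ofReal (ε / (ε ^ 2 + dist z x ^ 2)) +
          v z * ENNReal.ofReal (Metric.infDist z S / (Metric.infDist z S ^ 2 + dist z x ^ 2))) ∂mu := by
        apply lintegral_mono; intro z
        simp only [ha, recip]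
        split_ifs with hz
        · rw [← mul_add (v z), mul_left_comm _ (v z), mul_assoc (v z)]
          refine mul_le_mul_right ?_ (v z)
          set d := Metric.infDist z S
          set D := dist z x
          have hd0 : 0 ≤ d := Metric.infDist_nonneg
          have hdD : d ≤ D := Metric.infDist_le_dist_of_mem hx1
          have hD : 0 < D := hε.trans hz
          rw [← ENNReal.ofReal_add (by positivity) (by positivity),
            ← ENNReal.ofReal_pow (by positivity), ← ENNReal.ofReal_mul (by positivity),
            ← ENNReal.ofReal_mul (by positivity)]
          apply ENNReal.ofReal_le_ofReal
          have key : ∀ b : ℝ, 0 ≤ b → b ≤ D → b / D ^ 2 ≤ 2 * (b / (b ^ 2 + D ^ 2)) := by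
            intro b hb hbD
            rw [← mul_div_assoc, div_le_div_iff₀ (by positivity) (by positivity)]
            have : b ^ 2 ≤ D ^ 2 := pow_le_pow_left₀ hb hbD 2
            nlinarith
          have k1 := key ε hε.le hz.le
          have k2 := key d hd0 hdD
          calc (1 / D) ^ 2 * (72 * lam * (ε + d)) = 72 * lam * (ε / D ^ 2 + d / D ^ 2) := by
                field_simp
            _ ≤ 72 * lam * (2 * (ε / (ε ^ 2 + D ^ 2)) + 2 * (d / (d ^ 2 + D ^ 2))) := by gcongr
            _ = _ := by ring
        · simp
    _ = ENNReal.ofReal (144 * lam) *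
          (∫⁻ z, v z * ENNReal.ofReal (ε / (ε ^ 2 + dist z x ^ 2)) ∂mu + Jint v S x) := by
        rw [lintegral_const_mul' _ _ ENNReal.ofReal_ne_top, lintegral_add_right]
        · rfl
        · exact (Jint_meas v hv S).comp measurable_prodMk_right
    _ ≤ ENNReal.ofReal (144 * lam) * (ENNReal.ofReal (8 * lam) + ENNReal.ofReal lam) := by
        gcongr
    _ = _ := by
        rw [← ENNReal.ofReal_add (by positivity) (by positivity),
          ← ENNReal.ofReal_mul (by positivity)]
        congr 1; ring


/-! ### Part 4: oscillation of one dimensional partial sums -/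

/-- Analytic Dirichlet kernel. -/
def En (n : ℕ) (t : TT) : ℂ := ∑ m ∈ Finset.range n, fourier ((m : ℤ) + 1) t

lemma norm_fourier (k : ℤ) (t : TT) : ‖fourier k t‖ = 1 := by
  rw [fourier_apply]; exact Circle.norm_coe _

lemma En_mul (n : ℕ) (t : TT) :
    En n t * (fourier 1 t - 1) = fourier ((n : ℤ) + 1) t - fourier 1 t := by
  induction n with
  | zero => simp [En]
  | succ n ih =>
    have h : En (n + 1) t = En n t + fourier ((n : ℤ) + 1) t := by
      simp [En, Finset.sum_range_succ]
    rw [h, add_mul, ih]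
    push_cast
    rw [fourier_add (m := (n : ℤ) + 1) (n := 1)]
    ring

lemma dist_le_fourier (t : TT) : 2 / Real.pi * ‖t‖ ≤ ‖fourier 1 t - 1‖ := by
  obtain ⟨s, rfl⟩ : ∃ s : ℝ, (s : TT) = t := QuotientAddGroup.mk_surjective t
  have hpi := Real.pi_pos
  set s' : ℝ := s - round ((2 * Real.pi)⁻¹ * s) * (2 * Real.pi) with hs'
  have hs : ((s' : ℝ) : TT) = (s : TT) := by
    rw [hs', AddCircle.coe_sub, sub_eq_self, AddCircle.coe_eq_zero_iff]
    exact ⟨round ((2 * Real.pi)⁻¹ * s), by simp⟩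
  have h1 : ‖(s : TT)‖ = |s'| := AddCircle.norm_eq _
  have hb : |s'| ≤ Real.pi := by
    rw [← h1]
    refine (AddCircle.norm_le_half_period (2 * Real.pi) (by positivity)).trans ?_
    rw [abs_of_pos (by positivity)]; linarith
  have h2 : ‖fourier 1 (s' : TT) - 1‖ = ‖2 * Real.sin (s' / 2)‖ := by
    rw [fourier_coe_apply, ← Complex.norm_exp_I_mul_ofReal_sub_one]
    congr 3
    push_cast
    field_simp
  rw [h1, ← hs, h2, norm_mul, Real.norm_eq_abs, Real.norm_eq_abs, abs_two]
  have h3 : 2 / Real.pi * |s' / 2| ≤ |Real.sin (s' / 2)| := by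
    apply Real.mul_abs_le_abs_sin
    rw [abs_div, abs_two]; linarith
  rw [abs_div, abs_two] at h3
  linarith

lemma fourier_sub_arg (k : ℤ) (s t : TT) :
    fourier k (s - t) = fourier k s * (starRingEnd ℂ) (fourier k t) := by
  simp only [fourier_apply, sub_eq_add_neg, smul_add, smul_neg, AddCircle.toCircle_add,
    AddCircle.toCircle_neg, Circle.coe_mul, Circle.coe_inv_eq_conj]

lemma Dkernel_le (N : ℕ) (hN : 0 < N) (t : TT) :
    ‖∑ j ∈ Finset.range (2 * N), fourier (j : ℤ) t‖ ^ 2 ≤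
      14 * N ^ 2 * ((1 / (N : ℝ)) ^ 2 / ((1 / (N : ℝ)) ^ 2 + ‖t‖ ^ 2)) := by
  set D := ∑ j ∈ Finset.range (2 * N), fourier (j : ℤ) t with hD
  have hN' : (0 : ℝ) < N := by exact_mod_cast hN
  have h1 : ‖D‖ ≤ 2 * N := by
    refine (norm_sum_le _ _).trans ?_
    simp only [norm_fourier]
    simp
  have h2 : ‖D‖ * ‖fourier 1 t - 1‖ ≤ 2 := by
    rw [← norm_mul]
    have : D * (fourier 1 t - 1) = fourier ((2 * N : ℕ) : ℤ) t - 1 := by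
      rw [hD]
      generalize 2 * N = M
      induction M with
      | zero => simp
      | succ n ih =>
        rw [Finset.sum_range_succ, add_mul, ih]
        push_cast
        rw [fourier_add (m := (n : ℤ)) (n := 1)]
        ring
    rw [this]
    refine (norm_sub_le _ _).trans ?_
    rw [norm_fourier]; norm_num
  have h3 : ‖D‖ * ‖t‖ ≤ Real.pi := by
    have := mul_le_mul_of_nonneg_left (dist_le_fourier t) (norm_nonneg D)
    have h4 : ‖D‖ * (2 / Real.pi * ‖t‖) ≤ 2 := this.trans h2
    have hpi := Real.pi_pos
    rw [show ‖D‖ * (2 / Real.pi * ‖t‖) = (2 * (‖D‖ * ‖t‖)) / Real.pi by ring,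
      div_le_iff₀ hpi] at h4
    linarith
  have h5 : ‖D‖ ^ 2 * ‖t‖ ^ 2 ≤ 10 := by
    rw [← mul_pow]
    have := pow_le_pow_left₀ (by positivity) h3 2
    nlinarith [Real.pi_lt_d2, Real.pi_gt_three]
  have h6 : ‖D‖ ^ 2 ≤ 4 * N ^ 2 := by
    have := pow_le_pow_left₀ (by positivity) h1 2
    nlinarith
  have h7 : ‖D‖ ^ 2 * (1 / (N : ℝ)) ^ 2 ≤ 4 := by
    rw [one_div, inv_pow, ← div_eq_mul_inv, div_le_iff₀ (by positivity)]; exact h6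
  rw [← mul_div_assoc, le_div_iff₀ (by positivity)]
  rw [show 14 * (N : ℝ) ^ 2 * (1 / (N : ℝ)) ^ 2 = 14 by field_simp]
  linarith

lemma sum_sq_le (h : TT → ℂ) (hh : Integrable h mu) (x : TT) (N : ℕ) :
    ENNReal.ofReal (N * ∑ i ∈ Finset.range N, ‖∫ z, h z * fourier (i : ℤ) (x - z) ∂mu‖ ^ 2) ≤
      ∫⁻ z, ∫⁻ w, ‖h z‖ₑ * ‖h w‖ₑ *
        ENNReal.ofReal (‖∑ j ∈ Finset.range (2 * N), fourier (j : ℤ) (w - z)‖ ^ 2) ∂mu ∂mu := by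
  set B : ℤ → ℂ := fun k => ∫ z, h z * fourier k (x - z) ∂mu with hB
  have hIntg : ∀ k : ℤ, Integrable (fun z => h z * fourier k (x - z)) mu := by
    intro k
    refine hh.mul_bdd (c := 1) ?_ ?_
    · exact (by fun_prop : Continuous fun z : TT => fourier k (x - z)).aestronglyMeasurable
    · exact Eventually.of_forall fun z => (norm_fourier _ _).le
  -- combinatorial step
  have hcomb : (N : ℝ) * ∑ i ∈ Finset.range N, ‖B i‖ ^ 2 ≤
      ∑ j ∈ Finset.range (2 * N), ∑ j' ∈ Finset.range (2 * N), ‖B ((j : ℤ) - j')‖ ^ 2 := by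
    rw [Finset.sum_comm]
    calc (N : ℝ) * ∑ i ∈ Finset.range N, ‖B i‖ ^ 2
        = ∑ j' ∈ Finset.range N, ∑ i ∈ Finset.range N, ‖B i‖ ^ 2 := by simp
      _ ≤ ∑ j' ∈ Finset.range N, ∑ j ∈ Finset.range (2 * N), ‖B ((j : ℤ) - j')‖ ^ 2 := by
          apply Finset.sum_le_sum
          intro j' hj'
          have hj := Finset.mem_range.1 hj'
          calc ∑ i ∈ Finset.range N, ‖B i‖ ^ 2
              = ∑ j ∈ (Finset.range N).image (fun i => i + j'), ‖B ((j : ℤ) - j')‖ ^ 2 := by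
                rw [Finset.sum_image (fun a _ b _ hab => by simpa using hab)]
                simp
            _ ≤ _ := by
                apply Finset.sum_le_sum_of_subset_of_nonneg
                · intro j hj2
                  simp only [Finset.mem_image, Finset.mem_range] at hj2 ⊢
                  omega
                · intros; positivity
      _ ≤ _ := by
          apply Finset.sum_le_sum_of_subset_of_nonneg
          · intro j hj
            simp only [Finset.mem_range] at hj ⊢; omega
          · intros; positivity
  have hsq : ∀ k : ℤ, ((‖B k‖ ^ 2 : ℝ) : ℂ) = ∫ q : TT × TT,
      (h q.1 * fourier k (x - q.1)) * (starRingEnd ℂ) (h q.2 * fourier k (x - q.2)) ∂(mu.prod mu) := by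
    intro k
    rw [integral_prod_mul (fun z => h z * fourier k (x - z))
      (fun w => (starRingEnd ℂ) (h w * fourier k (x - w))), integral_conj, Complex.mul_conj,
      Complex.normSq_eq_norm_sq]
  have hsqi : ∀ k : ℤ, Integrable (fun q : TT × TT =>
      (h q.1 * fourier k (x - q.1)) * (starRingEnd ℂ) (h q.2 * fourier k (x - q.2))) (mu.prod mu) := by
    intro k
    exact (hIntg k).mul_prod (Complex.conjLIE.integrable_comp_iff.2 (hIntg k))
  have hDsq : ∀ t : TT, ((‖∑ j ∈ Finset.range (2 * N), fourier (j : ℤ) t‖ ^ 2 : ℝ) : ℂ) =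
      ∑ j ∈ Finset.range (2 * N), ∑ j' ∈ Finset.range (2 * N),
        fourier ((j : ℤ) - j') t := by
    intro t
    rw [← Complex.normSq_eq_norm_sq, ← Complex.mul_conj, map_sum, Finset.sum_mul_sum]
    apply Finset.sum_congr rfl; intro j _
    apply Finset.sum_congr rfl; intro j' _
    rw [← fourier_neg, ← fourier_add, sub_eq_add_neg]
  have hpt : ∀ (k : ℤ) (q : TT × TT), h q.1 * (starRingEnd ℂ) (h q.2) * fourier k (q.2 - q.1) =
      (h q.1 * fourier k (x - q.1)) * (starRingEnd ℂ) (h q.2 * fourier k (x - q.2)) := by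
    intro k q
    have e1 : fourier k (q.2 - q.1) = fourier k (x - q.1) * (starRingEnd ℂ) (fourier k (x - q.2)) := by
      rw [← fourier_sub_arg]; congr 1; abel
    rw [e1, map_mul]; ring
  have hfin : ((∑ j ∈ Finset.range (2 * N), ∑ j' ∈ Finset.range (2 * N),
      ‖B ((j : ℤ) - j')‖ ^ 2 : ℝ) : ℂ) = ∫ q : TT × TT, h q.1 * (starRingEnd ℂ) (h q.2) *
        ((‖∑ j ∈ Finset.range (2 * N), fourier (j : ℤ) (q.2 - q.1)‖ ^ 2 : ℝ) : ℂ)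
          ∂(mu.prod mu) := by
    simp only [hDsq]
    rw [Complex.ofReal_sum]
    simp_rw [Complex.ofReal_sum, Finset.mul_sum, hpt]
    rw [integral_finsetSum]
    · apply Finset.sum_congr rfl; intro j _
      rw [integral_finsetSum]
      · apply Finset.sum_congr rfl; intro j' _
        exact hsq _
      · intro j' _; exact hsqi _
    · intro j _
      exact integrable_finsetSum _ fun j' _ => hsqi _
  have hnn : (0 : ℝ) ≤ ∑ j ∈ Finset.range (2 * N), ∑ j' ∈ Finset.range (2 * N),
      ‖B ((j : ℤ) - j')‖ ^ 2 := by positivity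
  calc _ ≤ ENNReal.ofReal (∑ j ∈ Finset.range (2 * N), ∑ j' ∈ Finset.range (2 * N),
      ‖B ((j : ℤ) - j')‖ ^ 2) := ENNReal.ofReal_le_ofReal hcomb
    _ = ‖((∑ j ∈ Finset.range (2 * N), ∑ j' ∈ Finset.range (2 * N),
      ‖B ((j : ℤ) - j')‖ ^ 2 : ℝ) : ℂ)‖ₑ := by
        rw [← ofReal_norm, Complex.norm_real, Real.norm_of_nonneg hnn]
    _ ≤ _ := by
        rw [hfin]
        refine (enorm_integral_le_lintegral_enorm _).trans ?_
        rw [lintegral_prod]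
        · apply le_of_eq
          congr 1; ext z; congr 1; ext w
          rw [enorm_mul, enorm_mul, RCLike.enorm_conj]
          congr 1
          rw [← ofReal_norm, Complex.norm_real, Real.norm_of_nonneg (by positivity)]
        · have hc : Continuous fun q : TT × TT =>
              ((‖∑ j ∈ Finset.range (2 * N), fourier (j : ℤ) (q.2 - q.1)‖ ^ 2 : ℝ) : ℂ) := by
            fun_prop
          have h1 : AEStronglyMeasurable (fun q : TT × TT => h q.1 * (starRingEnd ℂ) (h q.2))
              (mu.prod mu) :=
            (hh.mul_prod (Complex.conjLIE.integrable_comp_iff.2 hh)).aestronglyMeasurable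
          exact (h1.mul hc.aestronglyMeasurable).enorm


lemma En_cont (n : ℕ) : Continuous (En n) := by
  unfold En; fun_prop

lemma En_diff_le (a i : ℕ) (t : TT) : ‖En (a + i) t - En a t‖ ≤ i := by
  unfold En
  rw [Finset.sum_range_add, add_sub_cancel_left]
  refine (norm_sum_le _ _).trans ?_
  simp only [norm_fourier]
  simp

lemma osc_1d (u : TT → ℂ) (hu : Continuous u) (lam : ℝ) (hlam : 0 < lam) (x : TT)
    (hx : x ∉ ExcSet (fun z => ‖u z‖ₑ) lam) (a N : ℕ) (hN : 0 < N) :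
    ∃ c : ℂ, ∑ i ∈ Finset.range N, ‖(∫ z, u z * En (a + i) (x - z) ∂mu) - c‖ ≤ 300 * lam * N := by
  have hN' : (0 : ℝ) < N := by exact_mod_cast hN
  set ε : ℝ := 1 / N with hε
  have hε0 : 0 < ε := by positivity
  set v : TT → ENNReal := fun z => ‖u z‖ₑ with hv
  have hvm : Measurable v := hu.measurable.enorm
  set S : Set TT := Metric.closedBall x ε with hS
  have hSm : MeasurableSet S := Metric.isClosed_closedBall.measurableSet
  obtain ⟨M, hM⟩ : ∃ M : ℝ, ∀ z, ‖u z‖ ≤ M := by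
    obtain ⟨M, hM⟩ := isCompact_univ.exists_bound_of_continuousOn (f := u) hu.continuousOn
    exact ⟨M, fun z => hM z (mem_univ z)⟩
  have hM0 : 0 ≤ M := (norm_nonneg _).trans (hM x)
  have hfar : ∀ z ∈ Sᶜ, ε < dist z x := by
    intro z hz; simpa [hS] using hz
  have hden : ∀ z ∈ Sᶜ, 2 / Real.pi * dist z x ≤ ‖fourier 1 (x - z) - 1‖ := by
    intro z hz
    rw [dist_comm, dist_eq_norm]; exact dist_le_fourier _
  have hden0 : ∀ z ∈ Sᶜ, fourier 1 (x - z) - 1 ≠ 0 := by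
    intro z hz h0
    have h1 := hden z hz
    rw [h0, norm_zero] at h1
    have : 0 < dist z x := hε0.trans (hfar z hz)
    have : 0 < 2 / Real.pi * dist z x := by positivity
    linarith
  set g : ℤ → TT → ℂ := fun k => Sᶜ.indicator
    (fun z => u z * (fourier k (x - z) / (fourier 1 (x - z) - 1))) with hg
  have hgm : ∀ k, Measurable (g k) := by
    intro k
    have h1 : Measurable fun z : TT => fourier k (x - z) :=
      (by fun_prop : Continuous fun z : TT => fourier k (x - z)).measurable
    have h2 : Measurable fun z : TT => fourier 1 (x - z) - 1 :=
      (by fun_prop : Continuous fun z : TT => fourier 1 (x - z) - 1).measurable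
    exact (hu.measurable.mul (h1.div h2)).indicator hSm.compl
  have hgb : ∀ k z, ‖g k z‖ₑ ≤ ENNReal.ofReal (Real.pi / 2) * (v z * recip x ε z) := by
    intro k z
    by_cases hz : z ∈ Sᶜ
    · simp only [hg, indicator_of_mem hz, recip, if_pos (hfar z hz)]
      have hd : 0 < dist z x := hε0.trans (hfar z hz)
      rw [enorm_mul, mul_left_comm _ (v z)]
      refine mul_le_mul_right ?_ (v z)
      rw [← ENNReal.ofReal_mul (by positivity), ← ofReal_norm, norm_div, norm_fourier]
      apply ENNReal.ofReal_le_ofReal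
      calc 1 / ‖fourier 1 (x - z) - 1‖ ≤ 1 / (2 / Real.pi * dist z x) := by
            apply one_div_le_one_div_of_le _ (hden z hz)
            positivity
        _ = _ := by field_simp
    · simp [hg, hz]
  have hgb' : ∀ k z, ‖g k z‖ ≤ M * (Real.pi / 2 * N) := by
    intro k z
    by_cases hz : z ∈ Sᶜ
    · simp only [hg, indicator_of_mem hz]
      rw [norm_mul, norm_div, norm_fourier]
      have hd : ε < dist z x := hfar z hz
      gcongr
      · exact hM z
      · calc 1 / ‖fourier 1 (x - z) - 1‖ ≤ 1 / (2 / Real.pi * ε) := by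
              apply one_div_le_one_div_of_le (by positivity)
              refine le_trans ?_ (hden z hz)
              gcongr
          _ = _ := by rw [hε]; field_simp
    · simp only [hg, indicator_of_notMem hz, norm_zero]; positivity
  have hgi : ∀ k, Integrable (g k) mu := fun k =>
    Integrable.of_bound (hgm k).aestronglyMeasurable _ (Eventually.of_forall (hgb' k))
  have hEi : ∀ n, Integrable (fun z => u z * En n (x - z)) mu := by
    intro n
    have hc : Continuous fun z => u z * En n (x - z) := by
      have := En_cont n
      fun_prop
    exact hc.integrable_of_hasCompactSupport (HasCompactSupport.of_compactSpace _)
  -- the pointwise split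
  have hsplit : ∀ n, ∫ z, u z * En n (x - z) ∂mu =
      ∫ z in S, u z * En n (x - z) ∂mu + ((∫ z, g ((n : ℤ) + 1) z ∂mu) - ∫ z, g 1 z ∂mu) := by
    intro n
    rw [← integral_add_compl hSm (hEi n), ← integral_sub (hgi _) (hgi _)]
    congr 1
    rw [← integral_indicator hSm.compl]
    congr 1; ext z
    by_cases hz : z ∈ Sᶜ
    · simp only [hg, indicator_of_mem hz]
      rw [← mul_sub, ← sub_div, ← En_mul, mul_div_cancel_right₀ _ (hden0 z hz)]
    · simp [hg, hz]
  refine ⟨∫ z in S, u z * En a (x - z) ∂mu - ∫ z, g 1 z ∂mu, ?_⟩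
  have hnear : ∀ i ∈ Finset.range N,
      ‖∫ z in S, u z * En (a + i) (x - z) ∂mu - ∫ z in S, u z * En a (x - z) ∂mu‖ ≤ lam := by
    intro i hi
    rw [← integral_sub (hEi _).integrableOn (hEi _).integrableOn]
    have h1 : ‖∫ z in S, (u z * En (a + i) (x - z) - u z * En a (x - z)) ∂mu‖ₑ
        ≤ ENNReal.ofReal lam := by
      refine (enorm_integral_le_lintegral_enorm _).trans ?_
      calc ∫⁻ z in S, ‖u z * En (a + i) (x - z) - u z * En a (x - z)‖ₑ ∂mu
          ≤ ∫⁻ z in S, ENNReal.ofReal N * v z ∂mu := by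
            apply lintegral_mono; intro z
            simp only []
            rw [← mul_sub, enorm_mul, mul_comm (‖u z‖ₑ)]
            refine mul_le_mul_left ?_ (v z)
            rw [← ofReal_norm]
            apply ENNReal.ofReal_le_ofReal
            refine (En_diff_le a i _).trans ?_
            exact_mod_cast (Finset.mem_range.1 hi).le
        _ = ENNReal.ofReal N * ∫⁻ z in S, v z ∂mu := by
            rw [lintegral_const_mul _ hvm]
        _ ≤ ENNReal.ofReal N * ENNReal.ofReal (lam * ε) := by
            gcongr
            by_contra hcon
            push Not at hcon
            exact hx (Or.inl ⟨ε, hε0, hcon⟩)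
        _ = _ := by
            rw [← ENNReal.ofReal_mul (by positivity)]
            congr 1; rw [hε]; field_simp
    rw [← ofReal_norm] at h1
    exact (ENNReal.ofReal_le_ofReal_iff hlam.le).1 h1
  set B : ℕ → ℂ := fun i => ∫ z, g ((a : ℤ) + 1) z * fourier (i : ℤ) (x - z) ∂mu with hB
  have hgB : ∀ i : ℕ, ∫ z, g (((a + i : ℕ) : ℤ) + 1) z ∂mu = B i := by
    intro i
    simp only [hB]
    congr 1; ext z
    by_cases hz : z ∈ Sᶜ
    · simp only [hg, indicator_of_mem hz]
      rw [show (((a + i : ℕ) : ℤ) + 1) = ((a : ℤ) + 1) + i by push_cast; ring, fourier_add]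
      ring
    · simp [hg, hz]
  have hquad := quad_bound v hvm lam hlam x hx ε hε0
  have hL2 := sum_sq_le (g ((a : ℤ) + 1)) (hgi _) x N
  have hbig : (N : ℝ) * ∑ i ∈ Finset.range N, ‖B i‖ ^ 2 ≤ 45360 * lam ^ 2 * N ^ 2 := by
    have hle : ENNReal.ofReal (N * ∑ i ∈ Finset.range N, ‖B i‖ ^ 2) ≤
        ENNReal.ofReal ((Real.pi / 2) ^ 2 * (14 * N ^ 2)) * ENNReal.ofReal (1296 * lam ^ 2) := by
      refine hL2.trans (le_trans ?_ (mul_le_mul_right hquad _))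
      rw [← lintegral_const_mul' _ _ ENNReal.ofReal_ne_top]
      apply lintegral_mono; intro z
      simp only []
      rw [← lintegral_const_mul' _ _ ENNReal.ofReal_ne_top]
      apply lintegral_mono; intro w
      simp only []
      have hD : ENNReal.ofReal (‖∑ j ∈ Finset.range (2 * N), fourier (j : ℤ) (w - z)‖ ^ 2) ≤
          ENNReal.ofReal (14 * N ^ 2) * ENNReal.ofReal (ε ^ 2 / (ε ^ 2 + dist z w ^ 2)) := by
        rw [← ENNReal.ofReal_mul (by positivity)]
        apply ENNReal.ofReal_le_ofReal
        rw [dist_comm, dist_eq_norm]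
        exact Dkernel_le N hN (w - z)
      calc _ ≤ (ENNReal.ofReal (Real.pi / 2) * (v z * recip x ε z)) *
            (ENNReal.ofReal (Real.pi / 2) * (v w * recip x ε w)) *
            (ENNReal.ofReal (14 * N ^ 2) * ENNReal.ofReal (ε ^ 2 / (ε ^ 2 + dist z w ^ 2))) :=
            mul_le_mul' (mul_le_mul' (hgb _ z) (hgb _ w)) hD
        _ = (ENNReal.ofReal (Real.pi / 2) * ENNReal.ofReal (Real.pi / 2) *
              ENNReal.ofReal (14 * N ^ 2)) *
            (v z * recip x ε z * (v w * recip x ε w) *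
              ENNReal.ofReal (ε ^ 2 / (ε ^ 2 + dist z w ^ 2))) := by
            generalize v z * recip x ε z = A
            generalize v w * recip x ε w = A'
            generalize ENNReal.ofReal (Real.pi / 2) = P
            generalize ENNReal.ofReal (ε ^ 2 / (ε ^ 2 + dist z w ^ 2)) = K
            ring
        _ = _ := by
            rw [← ENNReal.ofReal_mul (by positivity), ← ENNReal.ofReal_mul (by positivity), ← pow_two]
    rw [← ENNReal.ofReal_mul (by positivity), ENNReal.ofReal_le_ofReal_iff (by positivity)] at hle
    refine hle.trans ?_
    have hpi : Real.pi ^ 2 ≤ 10 := by nlinarith [Real.pi_lt_d2, Real.pi_gt_three]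
    have : 0 ≤ lam ^ 2 * (N : ℝ) ^ 2 := by positivity
    nlinarith
  have hsum : ∑ i ∈ Finset.range N, ‖B i‖ ≤ 213 * lam * N := by
    have hcs := sq_sum_le_card_mul_sum_sq (s := Finset.range N) (f := fun i => ‖B i‖)
    rw [Finset.card_range] at hcs
    refine (sq_le_sq₀ (by positivity) (by positivity)).1 (hcs.trans (hbig.trans ?_))
    nlinarith [mul_pos (pow_pos hlam 2) (pow_pos hN' 2)]
  calc _ ≤ ∑ i ∈ Finset.range N, (lam + ‖B i‖) := by
        apply Finset.sum_le_sum
        intro i hi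
        rw [hsplit, hgB]
        refine le_trans (le_of_eq ?_) ((norm_add_le _ _).trans (add_le_add_left (hnear i hi) ‖B i‖))
        congr 1; ring
    _ = N * lam + ∑ i ∈ Finset.range N, ‖B i‖ := by
        rw [Finset.sum_add_distrib]; simp
    _ ≤ N * lam + 213 * lam * N := by gcongr
    _ ≤ _ := by nlinarith [mul_pos hlam hN']


/-! ### Part 5: the two dimensional version via Fubini -/

/-- Normalized measure on the two-torus. -/
abbrev mu2 : Measure (TT × TT) := mu.prod mu

/-- Analytic partial sums in the first variable. -/
def PS (G : TT × TT → ℂ) (n : ℕ) (p : TT × TT) : ℂ := ∫ z, G (z, p.2) * En n (p.1 - z) ∂mu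

lemma PS_cont (G : TT × TT → ℂ) (hG : Continuous G) (n : ℕ) : Continuous (PS G n) := by
  have hE := En_cont n
  have := continuous_parametric_integral_of_continuous (μ := mu)
    (f := fun (p : TT × TT) (z : TT) => G (z, p.2) * En n (p.1 - z)) (s := univ)
    (by unfold Function.uncurry; fun_prop) isCompact_univ
  simp only [Measure.restrict_univ] at this
  exact this

lemma mean_osc (w : ℕ → ℂ) (N : ℕ) (hN : 0 < N) (c : ℂ) (K : ℝ)
    (h : ∑ i ∈ Finset.range N, ‖w i - c‖ ≤ K) :
    ∑ i ∈ Finset.range N, ‖w i - (∑ j ∈ Finset.range N, w j) / N‖ ≤ 2 * K := by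
  have hN' : (0 : ℝ) < N := by exact_mod_cast hN
  have hNc : (N : ℂ) ≠ 0 := by exact_mod_cast hN.ne'
  have h1 : ‖c - (∑ j ∈ Finset.range N, w j) / N‖ ≤ K / N := by
    have : c - (∑ j ∈ Finset.range N, w j) / N = -((∑ j ∈ Finset.range N, (w j - c)) / N) := by
      rw [Finset.sum_sub_distrib]; simp; field_simp; ring
    rw [this, norm_neg, norm_div, Complex.norm_natCast]
    gcongr
    exact (norm_sum_le _ _).trans h
  calc _ ≤ ∑ i ∈ Finset.range N, (‖w i - c‖ + K / N) := by
        apply Finset.sum_le_sum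
        intro i _
        calc _ = ‖(w i - c) + (c - (∑ j ∈ Finset.range N, w j) / N)‖ := by congr 1; ring
          _ ≤ _ := (norm_add_le _ _).trans (by gcongr)
    _ = ∑ i ∈ Finset.range N, ‖w i - c‖ + K := by
        rw [Finset.sum_add_distrib]; simp; field_simp
    _ ≤ _ := by linarith

lemma bad_set (G : TT × TT → ℂ) (hG : Continuous G) (lam : ℝ) (hlam : 0 < lam) :
    ∃ Bad : Set (TT × TT), MeasurableSet Bad ∧
      mu2 Bad ≤ ENNReal.ofReal (13 / lam) * ∫⁻ p, ‖G p‖ₑ ∂mu2 ∧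
      ∀ p ∉ Bad, ∀ a N : ℕ, 0 < N →
        ∃ c : ℂ, ∑ i ∈ Finset.range N, ‖PS G (a + i) p - c‖ ≤ 600 * lam * N := by
  set m : ℕ → ℕ → TT × TT → ℂ := fun a N p => (∑ j ∈ Finset.range N, PS G (a + j) p) / N with hm
  set U : ℕ → ℕ → Set (TT × TT) := fun a N =>
    {p | 600 * lam * N < ∑ i ∈ Finset.range N, ‖PS G (a + i) p - m a N p‖} with hU
  have hUo : ∀ a N, IsOpen (U a N) := by
    intro a N
    apply isOpen_lt continuous_const
    have := PS_cont G hG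
    fun_prop
  refine ⟨⋃ a, ⋃ N, ⋃ (_ : 0 < N), U a N, ?_, ?_, ?_⟩
  · exact (isOpen_iUnion fun a => isOpen_iUnion fun N => isOpen_iUnion fun _ => hUo a N).measurableSet
  · rw [Measure.prod_apply_symm (isOpen_iUnion fun a => isOpen_iUnion fun N =>
      isOpen_iUnion fun _ => hUo a N).measurableSet]
    have hGm : Measurable fun p => ‖G p‖ₑ := hG.measurable.enorm
    rw [lintegral_prod_symm _ hGm.aemeasurable, ← lintegral_const_mul' _ _ ENNReal.ofReal_ne_top]
    apply lintegral_mono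
    intro y
    have hGy : Continuous fun z => G (z, y) := by fun_prop
    refine le_trans (measure_mono ?_) (mu_ExcSet_le (fun z => ‖G (z, y)‖ₑ) hGy.measurable.enorm
      lam hlam ?_)
    · intro x hx
      by_contra hcon
      simp only [mem_preimage, mem_iUnion] at hx
      obtain ⟨a, N, hN, hx⟩ := hx
      obtain ⟨c, hc⟩ := osc_1d (fun z => G (z, y)) hGy lam hlam x hcon a N hN
      have h2 := mean_osc (fun i => PS G (a + i) (x, y)) N hN c _ hc
      have h3 : 600 * lam * N < ∑ i ∈ Finset.range N, ‖PS G (a + i) (x, y) - m a N (x, y)‖ := hx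
      simp only [hm] at h3
      linarith
    · have : Integrable (fun z => G (z, y)) mu :=
        hGy.integrable_of_hasCompactSupport (HasCompactSupport.of_compactSpace _)
      exact this.2.ne
  · intro p hp a N hN
    refine ⟨m a N p, ?_⟩
    by_contra hcon
    push Not at hcon
    exact hp (mem_iUnion.2 ⟨a, mem_iUnion.2 ⟨N, mem_iUnion.2 ⟨hN, hcon⟩⟩⟩)


/-! ### Part 6: the maximal ergodic theorem -/

section Hopf
variable {X : Type*} [TopologicalSpace X] [CompactSpace X] [MeasurableSpace X] [BorelSpace X]

/-- Auxiliary maximal sequence. -/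
def hopfM (T : C(X, ℝ) →ₗ[ℝ] C(X, ℝ)) (f : C(X, ℝ)) : ℕ → C(X, ℝ)
  | 0 => 0
  | (k + 1) => (f + T (hopfM T f k)) ⊔ 0

lemma hopf_maximal (μ : Measure X) [IsFiniteMeasure μ] (T : C(X, ℝ) →ₗ[ℝ] C(X, ℝ))
    (hpos : ∀ h : C(X, ℝ), 0 ≤ h → 0 ≤ T h)
    (hIntg : ∀ h : C(X, ℝ), ∫ x, T h x ∂μ = ∫ x, h x ∂μ) (h1 : T 1 = 1)
    (g : C(X, ℝ)) (hg : 0 ≤ g) (lam : ℝ) (K : ℕ) :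
    ∃ A : Set X, MeasurableSet A ∧ lam * μ.real A ≤ ∫ x, g x ∂μ ∧
      ∀ x ∉ A, ∀ k ≤ K, ∑ j ∈ Finset.range k, (T ^ j) g x ≤ k * lam := by
  have hmono : ∀ a b : C(X, ℝ), a ≤ b → T a ≤ T b := by
    intro a b hab
    have := hpos (b - a) (sub_nonneg.2 hab)
    rw [map_sub] at this
    exact sub_nonneg.1 this
  have hci : ∀ h : C(X, ℝ), Integrable (fun x => h x) μ := fun h =>
    h.continuous.integrable_of_hasCompactSupport (HasCompactSupport.of_compactSpace _)
  set f : C(X, ℝ) := g - lam • 1 with hf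
  set M := hopfM T f with hM
  have hM0 : ∀ k, 0 ≤ M k := by
    intro k; cases k with
    | zero => exact le_refl _
    | succ k => exact le_sup_right
  have hMs : ∀ k, M (k + 1) = (f + T (M k)) ⊔ 0 := fun k => rfl
  have hMm : ∀ k, M k ≤ M (k + 1) := by
    intro k
    induction k with
    | zero => exact hM0 1
    | succ k ih =>
      rw [hMs (k + 1), hMs k]
      exact sup_le_sup_right (add_le_add_right (hmono _ _ ih) f) 0
  have hS : ∀ k, ∀ K, k ≤ K → (∑ j ∈ Finset.range k, (T ^ j) g) - ((k : ℝ) * lam) • 1 ≤ M K := by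
    intro k
    induction k with
    | zero => intro K _; simpa using hM0 K
    | succ k ih =>
      intro K hK
      obtain ⟨K', rfl⟩ : ∃ K', K = K' + 1 := ⟨K - 1, by omega⟩
      have h2 := hmono _ _ (ih K' (by omega))
      rw [hMs]
      refine le_trans ?_ le_sup_left
      refine le_trans (le_of_eq ?_) (add_le_add_right h2 f)
      rw [Finset.sum_range_succ', map_sub, map_sum, map_smul, h1, hf]
      simp only [pow_succ', Module.End.mul_apply, pow_zero, Module.End.one_apply]
      push_cast
      rw [add_mul, add_smul, one_mul]
      abel
  refine ⟨{x | 0 < M K x}, (isOpen_lt continuous_const (M K).continuous).measurableSet, ?_, ?_⟩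
  · set A := {x | 0 < M K x} with hA
    have hAm : MeasurableSet A := (isOpen_lt continuous_const (M K).continuous).measurableSet
    have hpt : ∀ x ∈ A, M K x - T (M K) x ≤ f x := by
      intro x hx
      cases K with
      | zero => exact absurd hx (by simp [hA, hM, hopfM])
      | succ K =>
        have h3 : M (K + 1) x = max (f x + T (M K) x) 0 := rfl
        have h4 : (0 : ℝ) < M (K + 1) x := hx
        have h5 : T (M K) x ≤ T (M (K + 1)) x := hmono _ _ (hMm K) x
        rcases le_total (f x + T (M K) x) 0 with h6 | h6
        · rw [h3, max_eq_right h6] at h4; exact absurd h4 (lt_irrefl _)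
        · rw [h3, max_eq_left h6]; linarith
    have h7 : 0 ≤ ∫ x in A, f x ∂μ := by
      calc (0 : ℝ) = ∫ x, M K x ∂μ - ∫ x, T (M K) x ∂μ := by rw [hIntg]; ring
        _ ≤ ∫ x in A, M K x ∂μ - ∫ x in A, T (M K) x ∂μ := by
            apply sub_le_sub
            · apply le_of_eq
              rw [← integral_indicator hAm]
              congr 1; ext x
              by_cases hx : x ∈ A
              · rw [indicator_of_mem hx]
              · rw [indicator_of_notMem hx]
                exact le_antisymm (not_lt.1 hx) (hM0 K x)
            · exact setIntegral_le_integral (hci _)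
                (Eventually.of_forall fun x => hpos _ (hM0 K) x)
        _ = ∫ x in A, (M K x - T (M K) x) ∂μ := by
            rw [integral_sub (hci _).integrableOn (hci _).integrableOn]
        _ ≤ _ := by
            apply setIntegral_mono_on _ (hci _).integrableOn hAm hpt
            exact ((hci _).sub (hci _)).integrableOn
    have h8 : ∫ x in A, f x ∂μ = ∫ x in A, g x ∂μ - lam * μ.real A := by
      have : ∀ x, f x = g x - lam := fun x => by simp [hf]
      simp only [this]
      rw [integral_sub (hci _).integrableOn (integrable_const _)]
      simp [mul_comm]
    have h9 : ∫ x in A, g x ∂μ ≤ ∫ x, g x ∂μ :=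
      setIntegral_le_integral (hci _) (Eventually.of_forall fun x => hg x)
    linarith
  · intro x hx k hk
    have h3 : ((∑ j ∈ Finset.range k, (T ^ j) g) - ((k : ℝ) * lam) • 1 : C(X, ℝ)) x ≤ M K x :=
      hS k K hk x
    have h4 : M K x ≤ 0 := not_lt.1 hx
    simp only [ContinuousMap.sub_apply, ContinuousMap.sum_apply, ContinuousMap.smul_apply,
      ContinuousMap.one_apply, smul_eq_mul, mul_one] at h3
    linarith

end Hopf

/-! ### Part 7: Poisson means -/

/-- The Cauchy kernel. -/
def cauchyK (r : ℝ) (t : TT) : ℂ := (1 - r * fourier 1 t)⁻¹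

lemma cauchyK_ne (r : ℝ) (hr0 : 0 ≤ r) (hr1 : r < 1) (t : TT) : (1 : ℂ) - r * fourier 1 t ≠ 0 := by
  intro h
  have h1 : (r : ℂ) * fourier 1 t = 1 := (sub_eq_zero.1 h).symm
  have h2 := congrArg norm h1
  rw [norm_mul, norm_fourier, Complex.norm_real, Real.norm_of_nonneg hr0, norm_one] at h2
  linarith

lemma cauchyK_cont (r : ℝ) (hr0 : 0 ≤ r) (hr1 : r < 1) : Continuous (cauchyK r) := by
  unfold cauchyK
  exact Continuous.inv₀ (by fun_prop) (cauchyK_ne r hr0 hr1)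

lemma integral_fourier (m : ℤ) : ∫ t : TT, fourier m t ∂mu = if m = 0 then 1 else 0 := by
  split_ifs with h
  · subst h; simp
  · have hij : m ≠ 0 := h
    exact integral_eq_zero_of_add_right_eq_neg (μ := mu)
      (fourier_add_half_inv_index hij factTwoPi.out)

lemma cont_integrable (h : TT → ℂ) (hh : Continuous h) : Integrable h mu :=
  hh.integrable_of_hasCompactSupport (HasCompactSupport.of_compactSpace _)

lemma cauchyK_coef (r : ℝ) (hr0 : 0 ≤ r) (hr1 : r < 1) (m : ℤ) :
    ∫ t, cauchyK r t * fourier m t ∂mu = if m ≤ 0 then (r : ℂ) ^ m.natAbs else 0 := by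
  have hc := cauchyK_cont r hr0 hr1
  set I : ℤ → ℂ := fun m => ∫ t, cauchyK r t * fourier m t ∂mu with hI
  have hrec : ∀ m, I m = (if m = 0 then 1 else 0) + r * I (m + 1) := by
    intro m
    rw [← integral_fourier, hI]
    simp only []
    rw [← integral_const_mul, ← integral_add (cont_integrable _ (by fun_prop))
      (cont_integrable _ (by fun_prop))]
    congr 1; ext t
    rw [fourier_add]
    have := cauchyK_ne r hr0 hr1 t
    unfold cauchyK
    field_simp
    ring
  obtain ⟨C, hC⟩ : ∃ C, ∀ t, ‖cauchyK r t‖ ≤ C := by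
    obtain ⟨M, hM⟩ := isCompact_univ.exists_bound_of_continuousOn (f := cauchyK r) hc.continuousOn
    exact ⟨M, fun z => hM z (mem_univ z)⟩
  have hIb : ∀ m, ‖I m‖ ≤ C := by
    intro m
    refine (norm_integral_le_of_norm_le_const (C := C) (Eventually.of_forall fun t => ?_)).trans ?_
    · rw [norm_mul, norm_fourier, mul_one]; exact hC t
    · simp
  have hstep : ∀ (m : ℤ), 1 ≤ m → ∀ k : ℕ, I m = (r : ℂ) ^ k * I (m + k) := by
    intro m hm k
    induction k with
    | zero => simp
    | succ k ih =>
      rw [ih, hrec (m + k), if_neg (by omega)]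
      push_cast
      rw [add_assoc m (k : ℤ) 1]
      ring
  have hp : ∀ m : ℤ, 1 ≤ m → I m = 0 := by
    intro m hm
    have h1 : ∀ k : ℕ, ‖I m‖ ≤ r ^ k * C := by
      intro k
      rw [hstep m hm k, norm_mul, norm_pow, Complex.norm_real, Real.norm_of_nonneg hr0]
      gcongr
      exact hIb _
    have h2 : Tendsto (fun k : ℕ => r ^ k * C) atTop (nhds (0 * C)) :=
      (tendsto_pow_atTop_nhds_zero_of_lt_one hr0 hr1).mul_const C
    have h3 := ge_of_tendsto' h2 h1
    rw [zero_mul] at h3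
    exact norm_le_zero_iff.1 h3
  have hn : ∀ k : ℕ, I (-(k : ℤ)) = (r : ℂ) ^ k := by
    intro k
    induction k with
    | zero => rw [hrec]; simp [hp 1 le_rfl]
    | succ k ih =>
      rw [hrec, if_neg (by omega), show -((k + 1 : ℕ) : ℤ) + 1 = -(k : ℤ) by push_cast; ring, ih]
      ring
  split_ifs with h
  · obtain ⟨k, hk⟩ : ∃ k : ℕ, m = -(k : ℤ) := ⟨m.natAbs, by omega⟩
    rw [hk, Int.natAbs_neg, Int.natAbs_natCast]; exact hn k
  · exact hp m (by omega)

/-- The Poisson kernel. -/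
def poissonK (r : ℝ) (t : TT) : ℝ := 2 * (cauchyK r t).re - 1

lemma poissonK_cont (r : ℝ) (hr0 : 0 ≤ r) (hr1 : r < 1) : Continuous (poissonK r) := by
  have := cauchyK_cont r hr0 hr1
  unfold poissonK
  exact (continuous_const.mul (Complex.continuous_re.comp this)).sub continuous_const

lemma poissonK_nonneg (r : ℝ) (hr0 : 0 ≤ r) (hr1 : r < 1) (t : TT) : 0 ≤ poissonK r t := by
  unfold poissonK cauchyK
  rw [Complex.inv_re]
  set w : ℂ := fourier 1 t with hw
  have h1 : w.re ^ 2 + w.im ^ 2 = 1 := by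
    have := norm_fourier 1 t
    rw [← hw] at this
    have h2 := Complex.normSq_eq_norm_sq w
    rw [this, Complex.normSq_apply] at h2
    nlinarith
  have h0 := Complex.normSq_pos.2 (cauchyK_ne r hr0 hr1 t)
  rw [← hw] at h0
  rw [sub_nonneg, ← mul_div_assoc, le_div_iff₀ h0, Complex.normSq_apply]
  simp
  nlinarith [mul_nonneg hr0 hr0, mul_le_one₀ hr1.le hr0 hr1.le,
    congrArg (fun q => r * r * q) h1]

lemma poissonK_coef (r : ℝ) (hr0 : 0 ≤ r) (hr1 : r < 1) (m : ℤ) :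
    ∫ t, (poissonK r t : ℂ) * fourier m t ∂mu = (r : ℂ) ^ m.natAbs := by
  have hc := cauchyK_cont r hr0 hr1
  have h1 : ∀ t, (poissonK r t : ℂ) * fourier m t = cauchyK r t * fourier m t +
      ((starRingEnd ℂ) (cauchyK r t * fourier (-m) t) - fourier m t) := by
    intro t
    rw [map_mul, fourier_neg, Complex.conj_conj]
    have : (poissonK r t : ℂ) = cauchyK r t + (starRingEnd ℂ) (cauchyK r t) - 1 := by
      rw [Complex.add_conj]; unfold poissonK; push_cast; ring
    rw [this]; ring
  simp only [h1]
  rw [integral_add (cont_integrable _ (by fun_prop)) ((cont_integrable _ (by fun_prop))),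
    integral_sub (cont_integrable _ (by fun_prop)) (cont_integrable _ (by fun_prop)), integral_conj,
    cauchyK_coef r hr0 hr1, cauchyK_coef r hr0 hr1, integral_fourier]
  rcases lt_trichotomy m 0 with h | h | h
  · rw [if_pos (by omega), if_neg (by omega), if_neg (by omega)]; simp
  · subst h; simp
  · rw [if_neg (by omega), if_pos (by omega), if_neg (by omega)]; simp


/-- Characters of the two-torus. -/
def ee (q : ℤ × ℤ) (p : TT × TT) : ℂ := fourier q.1 p.1 * fourier q.2 p.2

lemma ee_cont (q : ℤ × ℤ) : Continuous (ee q) := by unfold ee; fun_prop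

lemma norm_ee (q : ℤ × ℤ) (p : TT × TT) : ‖ee q p‖ = 1 := by
  unfold ee; rw [norm_mul, norm_fourier, norm_fourier, one_mul]

lemma fourier_add_arg (k : ℤ) (s t : TT) : fourier k (s + t) = fourier k s * fourier k t := by
  simp only [fourier_apply, smul_add, AddCircle.toCircle_add, Circle.coe_mul]

lemma ee_add_arg (q : ℤ × ℤ) (p p' : TT × TT) : ee q (p + p') = ee q p * ee q p' := by
  unfold ee
  rw [Prod.fst_add, Prod.snd_add, fourier_add_arg, fourier_add_arg]; ring

lemma cont_integrable2 {E : Type*} [NormedAddCommGroup E] (h : TT × TT → E) (hh : Continuous h) :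
    Integrable h mu2 :=
  hh.integrable_of_hasCompactSupport (HasCompactSupport.of_compactSpace _)

/-- Trigonometric polynomials. -/
def trig (s : Finset (ℤ × ℤ)) (c : ℤ × ℤ → ℂ) (p : TT × TT) : ℂ := ∑ q ∈ s, c q * ee q p

lemma trig_cont (s : Finset (ℤ × ℤ)) (c : ℤ × ℤ → ℂ) : Continuous (trig s c) := by
  have := ee_cont
  unfold trig; fun_prop

/-- Twisted translation. -/
def ell (q : TT × TT) : TT × TT := (q.1 + q.2, q.1 - q.2)

lemma ell_cont : Continuous ell := by unfold ell; fun_prop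

/-- Averaging operator with a continuous kernel. -/
def avgOp (W : C(TT × TT, ℝ)) : C(TT × TT, ℝ) →ₗ[ℝ] C(TT × TT, ℝ) where
  toFun h := ⟨fun p => ∫ q, W q * h (p + ell q) ∂mu2, by
    have hl := ell_cont
    have := continuous_parametric_integral_of_continuous (μ := mu2)
      (f := fun (p : TT × TT) (q : TT × TT) => W q * h (p + ell q)) (s := univ)
      (by unfold Function.uncurry; fun_prop) isCompact_univ
    simp only [Measure.restrict_univ] at this
    exact this⟩
  map_add' a b := by
    have hl := ell_cont
    ext p
    simp only [ContinuousMap.coe_mk, ContinuousMap.add_apply, mul_add]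
    exact integral_add (cont_integrable2 _ (by fun_prop)) (cont_integrable2 _ (by fun_prop))
  map_smul' a b := by
    ext p
    simp only [ContinuousMap.coe_mk, ContinuousMap.smul_apply, smul_eq_mul, RingHom.id_apply,
      ← integral_const_mul]
    congr 1; ext q; ring

lemma avgOp_apply (W h : C(TT × TT, ℝ)) (p : TT × TT) :
    avgOp W h p = ∫ q, W q * h (p + ell q) ∂mu2 := rfl

lemma avgOp_nonneg (W : C(TT × TT, ℝ)) (hW : ∀ q, 0 ≤ W q) (h : C(TT × TT, ℝ)) (hh : 0 ≤ h) :
    0 ≤ avgOp W h := by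
  intro p
  change 0 ≤ avgOp W h p
  rw [avgOp_apply]
  exact integral_nonneg fun q => mul_nonneg (hW q) (hh _)

lemma avgOp_one (W : C(TT × TT, ℝ)) (hW : ∫ q, W q ∂mu2 = 1) : avgOp W 1 = 1 := by
  ext p
  rw [avgOp_apply]; simpa using hW

lemma avgOp_integral (W : C(TT × TT, ℝ)) (hW : ∫ q, W q ∂mu2 = 1) (h : C(TT × TT, ℝ)) :
    ∫ p, avgOp W h p ∂mu2 = ∫ p, h p ∂mu2 := by
  have hl := ell_cont
  simp only [avgOp_apply]
  rw [integral_integral_swap]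
  · have : ∀ q, ∫ p, W q * h (p + ell q) ∂mu2 = W q * ∫ p, h p ∂mu2 := by
      intro q
      rw [integral_const_mul, integral_add_right_eq_self (μ := mu2) (fun p => h p) (ell q)]
    simp only [this]
    rw [integral_mul_const, hW, one_mul]
  · have hc : Continuous (Function.uncurry fun (p q : TT × TT) => W q * h (p + ell q)) := by
      unfold Function.uncurry; fun_prop
    exact hc.integrable_of_hasCompactSupport (HasCompactSupport.of_compactSpace _)

/-- The two dimensional kernel. -/
def Wk (r : ℝ) (hr0 : 0 ≤ r) (hr1 : r < 1) : C(TT × TT, ℝ) :=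
  ⟨fun q => poissonK r q.1 * poissonK r q.2, by
    have := poissonK_cont r hr0 hr1
    fun_prop⟩

lemma Wk_nonneg (r : ℝ) (hr0 : 0 ≤ r) (hr1 : r < 1) (q : TT × TT) : 0 ≤ Wk r hr0 hr1 q :=
  mul_nonneg (poissonK_nonneg r hr0 hr1 _) (poissonK_nonneg r hr0 hr1 _)

/-- The square index of a frequency. -/
def sqi (q : ℤ × ℤ) : ℕ := max q.1.natAbs q.2.natAbs

lemma Wk_ee (r : ℝ) (hr0 : 0 ≤ r) (hr1 : r < 1) (q : ℤ × ℤ) :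
    ∫ z, (Wk r hr0 hr1 z : ℂ) * ee q (ell z) ∂mu2 = ((r ^ (2 * sqi q) : ℝ) : ℂ) := by
  have h1 : ∀ z : TT × TT, (Wk r hr0 hr1 z : ℂ) * ee q (ell z) =
      ((poissonK r z.1 : ℂ) * fourier (q.1 + q.2) z.1) *
        ((poissonK r z.2 : ℂ) * fourier (q.1 - q.2) z.2) := by
    intro z
    have h2 : (Wk r hr0 hr1 z : ℂ) = (poissonK r z.1 : ℂ) * (poissonK r z.2 : ℂ) := by
      simp [Wk]
    rw [h2]
    unfold ee ell
    simp only []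
    rw [fourier_add_arg, fourier_sub_arg, fourier_add, sub_eq_add_neg, fourier_add, fourier_neg]
    ring
  simp only [h1]
  rw [integral_prod_mul (fun t => (poissonK r t : ℂ) * fourier (q.1 + q.2) t)
    (fun t => (poissonK r t : ℂ) * fourier (q.1 - q.2) t), poissonK_coef r hr0 hr1,
    poissonK_coef r hr0 hr1, ← pow_add]
  push_cast
  congr 1
  unfold sqi
  omega

lemma Wk_one (r : ℝ) (hr0 : 0 ≤ r) (hr1 : r < 1) : ∫ z, Wk r hr0 hr1 z ∂mu2 = 1 := by
  have h := Wk_ee r hr0 hr1 (0, 0)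
  have h2 : ∀ z, (Wk r hr0 hr1 z : ℂ) * ee (0, 0) (ell z) = ((Wk r hr0 hr1 z : ℝ) : ℂ) := by
    intro z; simp [ee]
  simp only [h2] at h
  rw [integral_complex_ofReal] at h
  simpa [sqi] using h

/-- Real part of a trigonometric polynomial as a continuous map. -/
def reTrig (s : Finset (ℤ × ℤ)) (c : ℤ × ℤ → ℂ) : C(TT × TT, ℝ) :=
  ⟨fun p => (trig s c p).re, Complex.continuous_re.comp (trig_cont s c)⟩

lemma avgOp_reTrig (r : ℝ) (hr0 : 0 ≤ r) (hr1 : r < 1) (s : Finset (ℤ × ℤ)) (c : ℤ × ℤ → ℂ) :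
    avgOp (Wk r hr0 hr1) (reTrig s c) =
      reTrig s (fun q => ((r ^ (2 * sqi q) : ℝ) : ℂ) * c q) := by
  have hl := ell_cont
  have hee := ee_cont
  have ht := trig_cont s c
  ext p
  rw [avgOp_apply]
  have h1 : ∀ z, Wk r hr0 hr1 z * reTrig s c (p + ell z) =
      RCLike.re ((Wk r hr0 hr1 z : ℂ) * trig s c (p + ell z)) := by
    intro z
    simp [reTrig]
  simp only [h1]
  rw [integral_re (cont_integrable2 _ (by fun_prop))]
  change (_ : ℂ).re = (_ : ℂ).re
  congr 1
  unfold trig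
  simp_rw [Finset.mul_sum]
  rw [integral_finsetSum _ (fun q _ => cont_integrable2 _ (by fun_prop))]
  apply Finset.sum_congr rfl
  intro q _
  have h2 : ∀ z, (Wk r hr0 hr1 z : ℂ) * (c q * ee q (p + ell z)) =
      (c q * ee q p) * ((Wk r hr0 hr1 z : ℂ) * ee q (ell z)) := by
    intro z; rw [ee_add_arg]; ring
  simp only [h2]
  rw [integral_const_mul, Wk_ee]
  ring

lemma avgOp_pow_reTrig (r : ℝ) (hr0 : 0 ≤ r) (hr1 : r < 1) (s : Finset (ℤ × ℤ)) (c : ℤ × ℤ → ℂ)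
    (j : ℕ) : ((avgOp (Wk r hr0 hr1)) ^ j) (reTrig s c) =
      reTrig s (fun q => (((r ^ (2 * j)) ^ sqi q : ℝ) : ℂ) * c q) := by
  induction j with
  | zero => simp
  | succ j ih =>
    rw [pow_succ', Module.End.mul_apply, ih, avgOp_reTrig]
    congr 1; ext q
    rw [← mul_assoc, ← Complex.ofReal_mul]
    congr 2
    rw [← pow_mul, ← pow_mul, ← pow_add]
    congr 1; ring

/-- Square partial sums of a trigonometric polynomial. -/
def sqPS (s : Finset (ℤ × ℤ)) (c : ℤ × ℤ → ℂ) (n : ℕ) (p : TT × TT) : ℝ :=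
  (trig (s.filter fun q => sqi q ≤ n) c p).re

lemma sqPS_abel (s : Finset (ℤ × ℤ)) (c : ℤ × ℤ → ℂ) (p : TT × TT) (Q : ℝ) (h0 : 0 ≤ Q)
    (h1 : Q < 1) :
    HasSum (fun k : ℕ => (1 - Q) * Q ^ k * sqPS s c k p)
      (reTrig s (fun q => ((Q ^ sqi q : ℝ) : ℂ) * c q) p) := by
  have e1 : ∀ k : ℕ, (1 - Q) * Q ^ k * sqPS s c k p =
      ∑ q ∈ s, (if sqi q ≤ k then (1 - Q) * Q ^ k * (c q * ee q p).re else 0) := by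
    intro k
    unfold sqPS trig
    rw [Complex.re_sum, Finset.mul_sum, Finset.sum_filter]
  have e2 : reTrig s (fun q => ((Q ^ sqi q : ℝ) : ℂ) * c q) p =
      ∑ q ∈ s, Q ^ sqi q * (c q * ee q p).re := by
    change (trig s (fun q => ((Q ^ sqi q : ℝ) : ℂ) * c q) p).re = _
    unfold trig
    rw [Complex.re_sum]
    apply Finset.sum_congr rfl
    intro q _
    rw [mul_assoc, Complex.re_ofReal_mul]
  rw [e2]
  simp only [e1]
  apply hasSum_sum
  intro q _
  set a := (c q * ee q p).re
  set l := sqi q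
  have hgeo := ((hasSum_geometric_of_lt_one h0 h1).mul_left ((1 - Q) * Q ^ l * a))
  have hQ : (1 - Q) ≠ 0 := by linarith
  rw [show (1 - Q) * Q ^ l * a * (1 - Q)⁻¹ = Q ^ l * a by field_simp] at hgeo
  rw [← hasSum_nat_add_iff' l]
  have hz : ∑ i ∈ Finset.range l, (if l ≤ i then (1 - Q) * Q ^ i * a else 0) = 0 := by
    apply Finset.sum_eq_zero
    intro i hi
    rw [if_neg (by have := Finset.mem_range.1 hi; omega)]
  rw [hz, sub_zero]
  have hfun : (fun k => if l ≤ k + l then (1 - Q) * Q ^ (k + l) * a else 0) =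
      fun i => (1 - Q) * Q ^ l * a * Q ^ i := by
    ext k
    rw [if_pos (by omega), pow_add]; ring
  rw [hfun]; exact hgeo

lemma mean_bound (s : Finset (ℤ × ℤ)) (c : ℤ × ℤ → ℂ) (N : ℕ) (lam : ℝ) :
    ∃ A : Set (TT × TT), MeasurableSet A ∧ lam * mu2.real A ≤ ∫ p, |(trig s c p).re| ∂mu2 ∧
      ∀ p ∉ A, ∀ A0 : ℝ, OscLe (fun k => sqPS s c k p) A0 → ∀ n ≤ N,
        |(∑ k ∈ Finset.range (n + 1), sqPS s c k p) / ((n : ℝ) + 1)| ≤ 2 * lam + 32 * A0 := by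
  set δ : ℝ := 1 / ((N : ℝ) + 1) with hδ
  have hδ0 : 0 < δ := by positivity
  set r : ℝ := Real.exp (-(δ / 2)) with hr
  have hr0 : 0 ≤ r := (Real.exp_pos _).le
  have hr1 : r < 1 := by rw [hr, Real.exp_lt_one_iff]; linarith
  set T := avgOp (Wk r hr0 hr1) with hT
  set F := reTrig s c with hF
  have hpos : ∀ h : C(TT × TT, ℝ), 0 ≤ h → 0 ≤ T h := fun h hh =>
    avgOp_nonneg _ (Wk_nonneg r hr0 hr1) h hh
  obtain ⟨A, hAm, hA1, hA2⟩ := hopf_maximal mu2 T hpos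
    (fun h => avgOp_integral _ (Wk_one r hr0 hr1) h) (avgOp_one _ (Wk_one r hr0 hr1))
    |F| (abs_nonneg F) lam (2 * (N + 1))
  refine ⟨A, hAm, hA1, ?_⟩
  intro p hp A0 hosc n hn
  have hTabs : ∀ j : ℕ, |(T ^ j) F p| ≤ (T ^ j) |F| p := by
    have hposj : ∀ j : ℕ, ∀ h : C(TT × TT, ℝ), 0 ≤ h → 0 ≤ (T ^ j) h := by
      intro j
      induction j with
      | zero => intro h hh; simpa using hh
      | succ j ih => intro h hh; rw [pow_succ', Module.End.mul_apply]; exact hpos _ (ih h hh)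
    intro j
    have h1 : 0 ≤ (T ^ j) (|F| - F) p := hposj j _ (sub_nonneg.2 (le_abs_self F)) p
    have h2 : 0 ≤ (T ^ j) (|F| + F) p := hposj j _ (by
      have h3 : -F ≤ |F| := neg_le_abs F
      rw [← sub_neg_eq_add]
      exact sub_nonneg.2 h3) p
    rw [map_sub, ContinuousMap.sub_apply] at h1
    rw [map_add, ContinuousMap.add_apply] at h2
    rw [abs_le]; constructor <;> linarith
  set L := n + 1 with hL
  set J := N / L + 1 with hJ
  have hJL1 : N + 1 ≤ J * L := by
    have := Nat.lt_div_mul_add (a := N) (b := L) (by omega)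
    rw [hJ, add_mul, one_mul]; omega
  have hJL2 : J * L ≤ 2 * N + 1 := by
    have := Nat.div_mul_le_self N L
    rw [hJ, add_mul, one_mul]; omega
  have hJN : J ≤ N + 1 := by
    have hd := Nat.div_le_self N L
    rw [hJ]
    exact Nat.succ_le_succ hd
  have hJ0 : 0 < J := Nat.succ_pos _
  have hsum := hA2 p hp (2 * J) (by omega)
  obtain ⟨j, hj1, hj2, hj3⟩ : ∃ j, J ≤ j ∧ j < 2 * J ∧ (T ^ j) |F| p ≤ 2 * lam := by
    by_contra hcon
    push Not at hcon
    have h1 : ∑ j ∈ Finset.range J, (2 * lam) < ∑ j ∈ Finset.range J, (T ^ (J + j)) |F| p := by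
      apply Finset.sum_lt_sum_of_nonempty
      · exact ⟨0, Finset.mem_range.2 (by omega)⟩
      · intro i hi
        have := Finset.mem_range.1 hi
        exact hcon _ (by omega) (by omega)
    have h2 : 0 ≤ ∑ j ∈ Finset.range J, (T ^ j) |F| p :=
      Finset.sum_nonneg fun j _ => (abs_nonneg _).trans (hTabs j)
    rw [two_mul, Finset.sum_range_add] at hsum
    rw [Finset.sum_const, Finset.card_range, nsmul_eq_mul] at h1
    push_cast at hsum
    linarith
  set Q : ℝ := Real.exp (-(δ * j)) with hQ
  have hj0 : 0 < j := by omega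
  have hj0' : (0 : ℝ) < j := by exact_mod_cast hj0
  have hQr : r ^ (2 * j) = Q := by
    rw [hr, ← Real.exp_nat_mul, hQ]; congr 1; push_cast; ring
  have hQ1 : Q < 1 := by
    rw [hQ, Real.exp_lt_one_iff]; have := mul_pos hδ0 hj0'; linarith
  have hN1 : (0 : ℝ) < (N : ℝ) + 1 := by positivity
  have hlow : 1 ≤ δ * j * L := by
    have : (N : ℝ) + 1 ≤ j * L := by
      have : N + 1 ≤ j * L := hJL1.trans (Nat.mul_le_mul_right L hj1)
      exact_mod_cast this
    rw [hδ, mul_assoc, one_div, ← div_eq_inv_mul, le_div_iff₀ hN1]; linarith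
  have hup : δ * j * L ≤ 4 := by
    have : (j : ℝ) * L ≤ 4 * (N + 1) := by
      have : j * L ≤ 4 * (N + 1) := by
        calc j * L ≤ 2 * J * L := Nat.mul_le_mul_right L hj2.le
          _ = 2 * (J * L) := by ring
          _ ≤ _ := by omega
      exact_mod_cast this
    rw [hδ, mul_assoc, one_div, ← div_eq_inv_mul, div_le_iff₀ hN1]; linarith
  have habel := abel_mean (fun k => sqPS s c k p) A0 hosc L (by omega) Q (Real.exp_pos _) hQ1
    (by
      rw [hQ, ← Real.exp_nat_mul]
      have h1 : Real.exp (L * -(δ * j)) ≤ Real.exp (-1) := by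
        apply Real.exp_le_exp.2; linarith
      refine h1.trans ?_
      rw [Real.exp_neg, one_div]
      apply inv_anti₀ (by norm_num)
      linarith [Real.exp_one_gt_d9])
    (by
      have h1 : 1 - Q ≤ δ * j := by
        have := Real.add_one_le_exp (-(δ * j)); linarith
      have hL0 : (0 : ℝ) ≤ L := by positivity
      nlinarith)
    _ (sqPS_abel s c p Q (Real.exp_pos _).le hQ1)
  have h5 : reTrig s (fun q => ((Q ^ sqi q : ℝ) : ℂ) * c q) p = (T ^ j) F p := by
    rw [hT, hF, avgOp_pow_reTrig, hQr]
  rw [h5] at habel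
  have h6 := hTabs j
  have h7 : ((L : ℕ) : ℝ) = (n : ℝ) + 1 := by rw [hL]; push_cast; ring
  rw [h7] at habel
  linarith


/-! ### Part 8: exponential integrability of conjugate functions -/

/-- Square box of frequencies. -/
def box (R : ℕ) : Finset (ℤ × ℤ) := Finset.Icc (-(R : ℤ)) R ×ˢ Finset.Icc (-(R : ℤ)) R

lemma mem_box (R : ℕ) (q : ℤ × ℤ) :
    q ∈ box R ↔ (-(R : ℤ) ≤ q.1 ∧ q.1 ≤ R) ∧ (-(R : ℤ) ≤ q.2 ∧ q.2 ≤ R) := by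
  unfold box; simp [Finset.mem_product, Finset.mem_Icc]

lemma sum_box_neg {M : Type*} [AddCommMonoid M] (R : ℕ) (g : ℤ × ℤ → M) :
    ∑ q ∈ box R, g (-q) = ∑ q ∈ box R, g q := by
  refine Finset.sum_bij' (fun q _ => -q) (fun q _ => -q) ?_ ?_ ?_ ?_ ?_
  · intro q hq; rw [mem_box] at hq ⊢; simp only [Prod.fst_neg, Prod.snd_neg]; omega
  · intro q hq; rw [mem_box] at hq ⊢; simp only [Prod.fst_neg, Prod.snd_neg]; omega
  · intro q _; simp
  · intro q _; simp
  · intro q _; simp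

lemma ee_neg (q : ℤ × ℤ) (p : TT × TT) : ee (-q) p = (starRingEnd ℂ) (ee q p) := by
  unfold ee; rw [map_mul, Prod.fst_neg, Prod.snd_neg, fourier_neg, fourier_neg]

lemma trig_conj (R : ℕ) (c : ℤ × ℤ → ℂ) (p : TT × TT) :
    (starRingEnd ℂ) (trig (box R) c p) =
      trig (box R) (fun q => (starRingEnd ℂ) (c (-q))) p := by
  unfold trig
  rw [map_sum, ← sum_box_neg]
  apply Finset.sum_congr rfl
  intro q _
  rw [map_mul, ee_neg, Complex.conj_conj]

lemma trig_im_eq_zero (R : ℕ) (c : ℤ × ℤ → ℂ) (hc : ∀ q, c (-q) = (starRingEnd ℂ) (c q))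
    (p : TT × TT) : (trig (box R) c p).im = 0 := by
  have h := trig_conj R c p
  simp only [hc, Complex.conj_conj] at h
  exact Complex.conj_eq_iff_im.1 h

lemma trig_re_eq_zero (R : ℕ) (c : ℤ × ℤ → ℂ) (hc : ∀ q, c (-q) = -(starRingEnd ℂ) (c q))
    (p : TT × TT) : (trig (box R) c p).re = 0 := by
  have h := trig_conj R c p
  have h2 : trig (box R) (fun q => (starRingEnd ℂ) (c (-q))) p = - trig (box R) c p := by
    unfold trig
    rw [← Finset.sum_neg_distrib]
    apply Finset.sum_congr rfl
    intro q _
    simp only [hc]; simp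
  rw [h2] at h
  have h3 := congrArg Complex.re h
  rw [Complex.conj_re, Complex.neg_re] at h3
  linarith

lemma circle_mean (g : ℂ → ℂ) (hg : Differentiable ℂ g) :
    ∫ t : TT, g (fourier 1 t) ∂mu = g 0 := by
  have h1 := fourierCoeff_eq_intervalIntegral (T := 2 * Real.pi) (fun t : TT => g (fourier 1 t)) 0 0
  have h2 : fourierCoeff (fun t : TT => g (fourier 1 t)) 0 = ∫ t : TT, g (fourier 1 t) ∂mu := by
    unfold fourierCoeff; simp
  rw [← h2, h1]
  have h3 : DiffContOnCl ℂ g (Metric.ball 0 |1|) := hg.diffContOnCl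
  have h4 := h3.circleAverage
  rw [← h4, Real.circleAverage_def, zero_add]
  rw [one_div]
  congr 1
  apply intervalIntegral.integral_congr
  intro θ _
  simp only [neg_zero, fourier_zero, one_smul]
  congr 1
  rw [fourier_coe_apply, circleMap]
  simp only [Complex.ofReal_one, one_mul, zero_add]
  congr 1
  push_cast
  field_simp

/-- Translation direction. -/
def dirv (ε : ℤ) (t : TT) : TT × TT := (t, ε • t)

lemma dirv_cont (ε : ℤ) : Continuous (dirv ε) := by unfold dirv; fun_prop

lemma ee_dirv (ε : ℤ) (q : ℤ × ℤ) (t : TT) : ee q (dirv ε t) = fourier (q.1 + ε * q.2) t := by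
  unfold ee dirv
  simp only []
  rw [fourier_add]
  congr 1
  rw [fourier_apply, fourier_apply, smul_smul, mul_comm q.2 ε]

lemma exp_mean (ε : ℤ) (s : Finset (ℤ × ℤ)) (d : ℤ × ℤ → ℂ)
    (hd : ∀ q ∈ s, q.1 + ε * q.2 < 0 → d q = 0) (a : ℂ) :
    ∫ p, Complex.exp (a * trig s d p) ∂mu2 =
      ∫ p, Complex.exp (a * trig (s.filter fun q => q.1 + ε * q.2 = 0) d p) ∂mu2 := by
  have ht := trig_cont s d
  have hv := dirv_cont ε
  have hinner : ∀ p : TT × TT, ∫ t, Complex.exp (a * trig s d (p + dirv ε t)) ∂mu =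
      Complex.exp (a * trig (s.filter fun q => q.1 + ε * q.2 = 0) d p) := by
    intro p
    set g : ℂ → ℂ := fun z =>
      Complex.exp (a * ∑ q ∈ s, d q * ee q p * z ^ (q.1 + ε * q.2).natAbs) with hg
    have hgd : Differentiable ℂ g := by
      rw [hg]; fun_prop
    have h1 : ∀ t, Complex.exp (a * trig s d (p + dirv ε t)) = g (fourier 1 t) := by
      intro t
      rw [hg]
      simp only []
      congr 2
      unfold trig
      apply Finset.sum_congr rfl
      intro q hq
      rw [ee_add_arg, ee_dirv]
      rcases lt_or_ge (q.1 + ε * q.2) 0 with hneg | hnn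
      · rw [hd q hq hneg]; simp
      · have : fourier (q.1 + ε * q.2) t = (fourier 1 t) ^ (q.1 + ε * q.2).natAbs := by
          obtain ⟨k, hk⟩ : ∃ k : ℕ, q.1 + ε * q.2 = k := ⟨(q.1 + ε * q.2).natAbs, by omega⟩
          rw [hk, Int.natAbs_natCast]
          clear hk
          induction k with
          | zero => simp
          | succ k ih =>
            push_cast
            rw [fourier_add, ih, pow_succ]
        rw [this]; ring
    simp only [h1]
    rw [circle_mean g hgd, hg]
    simp only []
    congr 2
    unfold trig
    rw [Finset.sum_filter]
    apply Finset.sum_congr rfl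
    intro q _
    split_ifs with h
    · rw [h]; simp
    · rw [zero_pow (by omega), mul_zero]
  have htrans : ∀ t : TT, ∫ p, Complex.exp (a * trig s d (p + dirv ε t)) ∂mu2 =
      ∫ p, Complex.exp (a * trig s d p) ∂mu2 := fun t =>
    integral_add_right_eq_self (μ := mu2) (fun p => Complex.exp (a * trig s d p)) (dirv ε t)
  have hc : Continuous (Function.uncurry fun (p : TT × TT) (t : TT) =>
      Complex.exp (a * trig s d (p + dirv ε t))) := by
    unfold Function.uncurry; fun_prop
  calc ∫ p, Complex.exp (a * trig s d p) ∂mu2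
      = ∫ _t : TT, ∫ p, Complex.exp (a * trig s d p) ∂mu2 ∂mu := by simp
    _ = ∫ t : TT, ∫ p, Complex.exp (a * trig s d (p + dirv ε t)) ∂mu2 ∂mu := by
        congr 1; ext t; exact (htrans t).symm
    _ = ∫ p, ∫ t, Complex.exp (a * trig s d (p + dirv ε t)) ∂mu ∂mu2 := by
        rw [← integral_integral_swap]
        exact hc.integrable_of_hasCompactSupport (HasCompactSupport.of_compactSpace _)
    _ = _ := by
        congr 1; ext p; exact hinner p

/-- The sign multiplier. -/
def sg (ε : ℤ) (q : ℤ × ℤ) : ℂ := ((q.1 + ε * q.2).sign : ℂ)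

lemma sg_neg (ε : ℤ) (q : ℤ × ℤ) : sg ε (-q) = - sg ε q := by
  unfold sg
  rw [Prod.fst_neg, Prod.snd_neg, show -q.1 + ε * -q.2 = -(q.1 + ε * q.2) by ring, Int.sign_neg]
  push_cast; rfl

lemma sg_conj (ε : ℤ) (q : ℤ × ℤ) : (starRingEnd ℂ) (sg ε q) = sg ε q := by
  unfold sg; simp

lemma exp_int (ε : ℤ) (R : ℕ) (c : ℤ × ℤ → ℂ) (hc : ∀ q, c (-q) = (starRingEnd ℂ) (c q))
    (hb : ∀ p, ‖trig (box R) c p‖ ≤ 1) :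
    ∫ p, Real.exp |(trig (box R) (fun q => sg ε q * c q) p).im| ∂mu2 ≤ 4 := by
  set φ : TT × TT → ℝ := fun p => (trig (box R) c p).re with hφ
  set ψ : TT × TT → ℝ := fun p => (trig (box R) (fun q => sg ε q * c q) p).im with hψ
  have hφc : Continuous φ := Complex.continuous_re.comp (trig_cont _ _)
  have hψc : Continuous ψ := Complex.continuous_im.comp (trig_cont _ _)
  set d : ℤ × ℤ → ℂ := fun q => (1 + sg ε q) * c q with hd
  have hF : ∀ p, trig (box R) d p = (φ p : ℂ) + Complex.I * (ψ p : ℂ) := by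
    intro p
    have h1 : trig (box R) d p = trig (box R) c p + trig (box R) (fun q => sg ε q * c q) p := by
      unfold trig
      rw [← Finset.sum_add_distrib]
      apply Finset.sum_congr rfl
      intro q _
      simp only [hd]; ring
    have h2 := trig_im_eq_zero R c hc p
    have h3 := trig_re_eq_zero R (fun q => sg ε q * c q) (by
      intro q
      rw [sg_neg, hc, map_mul, sg_conj]; ring) p
    rw [h1]
    apply Complex.ext
    · simp [hφ, h3]
    · simp [hψ, h2]
  have hd0 : ∀ q ∈ box R, q.1 + ε * q.2 < 0 → d q = 0 := by
    intro q _ hq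
    simp [hd, sg, Int.sign_eq_neg_one_of_neg hq]
  have hsmall : ∀ σ : ℝ, |σ| = 1 →
      ∫ p, Real.exp (σ * ψ p) * Real.cos (φ p) ∂mu2 ≤ 1 := by
    intro σ hσ
    set a : ℂ := -(σ * Complex.I) with ha
    have h1 := exp_mean ε (box R) d hd0 a
    have hre : ∀ p, (Complex.exp (a * trig (box R) d p)).re =
        Real.exp (σ * ψ p) * Real.cos (φ p) := by
      intro p
      rw [hF, show a * ((φ p : ℂ) + Complex.I * (ψ p : ℂ)) =
        ((σ * ψ p : ℝ) : ℂ) + ((-(σ * φ p) : ℝ) : ℂ) * Complex.I by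
          rw [ha]; push_cast; linear_combination (-(σ : ℂ) * ψ p) * Complex.I_sq]
      rw [Complex.exp_re]
      have e1 : (((σ * ψ p : ℝ) : ℂ) + ((-(σ * φ p) : ℝ) : ℂ) * Complex.I).re = σ * ψ p := by simp
      have e2 : (((σ * ψ p : ℝ) : ℂ) + ((-(σ * φ p) : ℝ) : ℂ) * Complex.I).im = -(σ * φ p) := by
        simp
      rw [e1, e2, Real.cos_neg]
      rcases (abs_eq (by norm_num)).1 hσ with h | h
      · rw [h, one_mul, one_mul]
      · rw [h]; simp
    have htd := trig_cont (box R) d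
    calc ∫ p, Real.exp (σ * ψ p) * Real.cos (φ p) ∂mu2
        = ∫ p, RCLike.re (Complex.exp (a * trig (box R) d p)) ∂mu2 := by
          congr 1; ext p; exact (hre p).symm
      _ = (∫ p, Complex.exp (a * trig (box R) d p) ∂mu2).re :=
          integral_re (cont_integrable2 _ (by fun_prop))
      _ ≤ ‖∫ p, Complex.exp (a * trig (box R) d p) ∂mu2‖ := Complex.re_le_norm _
      _ ≤ 1 := by
          rw [h1]
          refine (norm_integral_le_of_norm_le_const (C := 1) (Eventually.of_forall fun p => ?_)).trans ?_
          · rw [Complex.norm_exp]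
            apply le_of_eq
            rw [Real.exp_eq_one_iff]
            have him : (trig ((box R).filter fun q => q.1 + ε * q.2 = 0) d p).im = 0 := by
              set c0 : ℤ × ℤ → ℂ := fun q => if q.1 + ε * q.2 = 0 then d q else 0 with hc0
              have : trig ((box R).filter fun q => q.1 + ε * q.2 = 0) d p = trig (box R) c0 p := by
                unfold trig
                rw [Finset.sum_filter]
                apply Finset.sum_congr rfl
                intro q _
                simp only [hc0]
                split_ifs <;> simp
              rw [this]
              apply trig_im_eq_zero
              intro q
              simp only [hc0, hd]
              have hiff : (-q).1 + ε * (-q).2 = 0 ↔ q.1 + ε * q.2 = 0 := by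
                rw [Prod.fst_neg, Prod.snd_neg]
                constructor <;> intro h <;> linarith
              by_cases h : q.1 + ε * q.2 = 0
              · rw [if_pos (hiff.2 h), if_pos h, hc, sg_neg]
                have : sg ε q = 0 := by simp [sg, h]
                rw [this]; simp
              · rw [if_neg (fun h' => h (hiff.1 h')), if_neg h]; simp
            rw [ha]
            simp [him]
          · simp
  have h1 := hsmall 1 (by norm_num)
  have h2 := hsmall (-1) (by norm_num)
  have hi1 : Integrable (fun p => Real.exp (1 * ψ p) * Real.cos (φ p)) mu2 :=
    cont_integrable2 _ (by fun_prop)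
  have hi2 : Integrable (fun p => Real.exp (-1 * ψ p) * Real.cos (φ p)) mu2 :=
    cont_integrable2 _ (by fun_prop)
  calc ∫ p, Real.exp |ψ p| ∂mu2
      ≤ ∫ p, 2 * (Real.exp (1 * ψ p) * Real.cos (φ p) + Real.exp (-1 * ψ p) * Real.cos (φ p)) ∂mu2 := by
        apply integral_mono (cont_integrable2 _ (by fun_prop)) (cont_integrable2 _ (by fun_prop))
        intro p
        simp only []
        have hφ1 : |φ p| ≤ 1 := (Complex.abs_re_le_norm _).trans (hb p)
        have hcos : 1 / 2 ≤ Real.cos (φ p) := by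
          have := Real.one_sub_sq_div_two_le_cos (x := φ p)
          have h3 : φ p ^ 2 ≤ 1 := (sq_le_one_iff_abs_le_one _).2 hφ1
          linarith
        have h4 : Real.exp |ψ p| ≤ Real.exp (1 * ψ p) + Real.exp (-1 * ψ p) := by
          rcases abs_cases (ψ p) with h | h
          · rw [h.1, one_mul]; linarith [Real.exp_pos (-1 * ψ p)]
          · rw [h.1]
            rw [show -1 * ψ p = - ψ p by ring]
            linarith [Real.exp_pos (1 * ψ p)]
        have h5 : 0 < Real.exp (1 * ψ p) + Real.exp (-1 * ψ p) := by positivity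
        rw [← add_mul]
        nlinarith
    _ = 2 * (∫ p, Real.exp (1 * ψ p) * Real.cos (φ p) ∂mu2 +
          ∫ p, Real.exp (-1 * ψ p) * Real.cos (φ p) ∂mu2) := by
        rw [integral_const_mul, integral_add hi1 hi2]
    _ ≤ 4 := by linarith


/-! ### Part 9: Zygmund inequality by duality -/

lemma young_log (a b : ℝ) (ha : 0 ≤ a) : a * b ≤ a * logPlus a + Real.exp b := by
  unfold logPlus
  split_ifs with h
  · have h0 : 0 < a := by linarith
    have h1 := Real.add_one_le_exp (b - Real.log a)
    have h2 : Real.exp b = a * Real.exp (b - Real.log a) := by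
      rw [Real.exp_sub, Real.exp_log h0]; field_simp
    rw [h2]
    nlinarith
  · have h1 := Real.add_one_le_exp b
    have h2 := Real.exp_pos b
    rcases le_total 0 b with hb | hb
    · nlinarith
    · nlinarith

lemma logPlus_nonneg (a : ℝ) : 0 ≤ logPlus a := by
  unfold logPlus; split_ifs with h
  · exact Real.log_nonneg h.le
  · exact le_rfl

/-- Dirichlet kernel. -/
def Dk (N : ℕ) (t : TT) : ℂ := ∑ j ∈ Finset.Icc (-(N : ℤ)) N, fourier j t

lemma Dk_cont (N : ℕ) : Continuous (Dk N) := by unfold Dk; fun_prop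

lemma Dk_sq (N : ℕ) : ∫ t, ‖Dk N t‖ ^ 2 ∂mu = 2 * N + 1 := by
  have h1 : ((∫ t, ‖Dk N t‖ ^ 2 ∂mu : ℝ) : ℂ) = 2 * N + 1 := by
    rw [← integral_complex_ofReal]
    have : ∀ t, ((‖Dk N t‖ ^ 2 : ℝ) : ℂ) = ∑ i ∈ Finset.Icc (-(N : ℤ)) N,
        ∑ j ∈ Finset.Icc (-(N : ℤ)) N, fourier (i - j) t := by
      intro t
      push_cast
      rw [← Complex.mul_conj']
      unfold Dk
      rw [map_sum, Finset.sum_mul_sum]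
      apply Finset.sum_congr rfl
      intro i _
      apply Finset.sum_congr rfl
      intro j _
      rw [sub_eq_add_neg, fourier_add, fourier_neg]
    simp only [this]
    rw [integral_finsetSum _ (fun i _ => cont_integrable _ (by fun_prop))]
    have h2 : ∀ i ∈ Finset.Icc (-(N : ℤ)) N,
        ∫ t : TT, ∑ j ∈ Finset.Icc (-(N : ℤ)) N, fourier (i - j) t ∂mu = 1 := by
      intro i hi
      rw [integral_finsetSum _ (fun j _ => cont_integrable _ (by fun_prop))]
      simp only [integral_fourier]
      rw [Finset.sum_eq_single_of_mem i hi]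
      · simp
      · intro j _ hj
        rw [if_neg]; intro h; apply hj; omega
    rw [Finset.sum_congr rfl h2]
    simp only [Finset.sum_const, Int.card_Icc, nsmul_eq_mul, mul_one]
    rw [show ((N : ℤ) + 1 - -(N : ℤ)).toNat = 2 * N + 1 by omega]
    push_cast; ring
  have h3 : ((2 * N + 1 : ℝ) : ℂ) = 2 * N + 1 := by push_cast; ring
  rw [← h3] at h1
  exact_mod_cast h1

/-- De la Vallee-Poussin weights. -/
def kap (N : ℕ) (m : ℤ) : ℝ :=
  (∑ i ∈ Finset.Icc (-(N : ℤ)) N,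
    if m - i ∈ Finset.Icc (-(2 * N : ℤ)) (2 * N) then (1 : ℝ) else 0) / (2 * N + 1)

lemma kap_neg (N : ℕ) (m : ℤ) : kap N (-m) = kap N m := by
  unfold kap
  congr 1
  refine Finset.sum_bij' (fun q _ => -q) (fun q _ => -q) ?_ ?_ ?_ ?_ ?_
  · intro q hq; rw [Finset.mem_Icc] at hq ⊢; omega
  · intro q hq; rw [Finset.mem_Icc] at hq ⊢; omega
  · intro q _; simp
  · intro q _; simp
  · intro q _
    simp only [Finset.mem_Icc]
    congr 1
    apply propext
    constructor <;> intro h <;> omega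

lemma kap_one (N : ℕ) (m : ℤ) (h1 : -(N : ℤ) ≤ m) (h2 : m ≤ N) : kap N m = 1 := by
  unfold kap
  have : ∀ i ∈ Finset.Icc (-(N : ℤ)) N,
      (if m - i ∈ Finset.Icc (-(2 * N : ℤ)) (2 * N) then (1 : ℝ) else 0) = 1 := by
    intro i hi
    rw [Finset.mem_Icc] at hi
    rw [if_pos]; rw [Finset.mem_Icc]; omega
  rw [Finset.sum_congr rfl this]
  simp only [Finset.sum_const, Int.card_Icc, nsmul_eq_mul, mul_one]
  rw [show ((N : ℤ) + 1 - -(N : ℤ)).toNat = 2 * N + 1 by omega]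
  push_cast
  field_simp

/-- De la Vallee-Poussin kernel. -/
def Vk (N : ℕ) (t : TT) : ℂ := (2 * N + 1 : ℝ)⁻¹ * (Dk N t * Dk (2 * N) t)

lemma Vk_cont (N : ℕ) : Continuous (Vk N) := by
  have := Dk_cont
  unfold Vk; fun_prop

lemma Vk_eq (N : ℕ) (t : TT) :
    Vk N t = ∑ m ∈ Finset.Icc (-((3 * N : ℕ) : ℤ)) (3 * N : ℕ), (kap N m : ℂ) * fourier m t := by
  unfold Vk
  have h1 : Dk N t * Dk (2 * N) t = ∑ m ∈ Finset.Icc (-((3 * N : ℕ) : ℤ)) (3 * N : ℕ),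
      ∑ i ∈ Finset.Icc (-(N : ℤ)) N,
        if m - i ∈ Finset.Icc (-(2 * N : ℤ)) (2 * N) then fourier m t else 0 := by
    unfold Dk
    rw [Finset.sum_mul_sum, Finset.sum_comm (s := Finset.Icc (-((3 * N : ℕ) : ℤ)) (3 * N : ℕ))]
    apply Finset.sum_congr rfl
    intro i hi
    rw [Finset.mem_Icc] at hi
    rw [← Finset.sum_filter]
    refine Finset.sum_bij' (fun j _ => i + j) (fun m _ => m - i) ?_ ?_ ?_ ?_ ?_
    · intro j hj; rw [Finset.mem_Icc] at hj
      rw [Finset.mem_filter, Finset.mem_Icc, Finset.mem_Icc]; push_cast at hj ⊢; omega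
    · intro m hm; rw [Finset.mem_filter, Finset.mem_Icc, Finset.mem_Icc] at hm
      rw [Finset.mem_Icc]; push_cast at hm ⊢; omega
    · intro j _; ring
    · intro j _; ring
    · intro j _; rw [fourier_add]
  rw [h1, Finset.mul_sum]
  apply Finset.sum_congr rfl
  intro m _
  unfold kap
  push_cast
  rw [Finset.mul_sum, div_eq_mul_inv, Finset.sum_mul, Finset.sum_mul]
  apply Finset.sum_congr rfl
  intro i _
  split_ifs
  · rw [Complex.ofReal_one]; ring
  · rw [Complex.ofReal_zero]; ring

lemma Vk_int (N : ℕ) : ∫ t, ‖Vk N t‖ ∂mu ≤ 3 / 2 := by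
  have hD := Dk_cont
  have hV := Vk_cont N
  have hpos : (0 : ℝ) < 2 * N + 1 := by positivity
  have hIntg : ∀ M : ℕ, Integrable (fun t => ‖Dk M t‖ ^ 2) mu := fun M =>
    Continuous.integrable_of_hasCompactSupport (by fun_prop) (HasCompactSupport.of_compactSpace _)
  calc ∫ t, ‖Vk N t‖ ∂mu
      ≤ ∫ t, (2 * N + 1 : ℝ)⁻¹ / 2 * (‖Dk N t‖ ^ 2 + ‖Dk (2 * N) t‖ ^ 2) ∂mu := by
        apply integral_mono
        · exact Continuous.integrable_of_hasCompactSupport (by fun_prop)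
            (HasCompactSupport.of_compactSpace _)
        · exact ((hIntg _).add (hIntg _)).const_mul _
        · intro t
          simp only [Vk]
          rw [norm_mul, norm_mul, Complex.norm_real, Real.norm_of_nonneg (by positivity)]
          have := two_mul_le_add_sq ‖Dk N t‖ ‖Dk (2 * N) t‖
          have h2 : 0 < (2 * N + 1 : ℝ)⁻¹ := by positivity
          nlinarith
    _ = (2 * N + 1 : ℝ)⁻¹ / 2 * ((2 * N + 1) + (2 * (2 * N : ℕ) + 1)) := by
        rw [integral_const_mul, integral_add (hIntg _) (hIntg _), Dk_sq, Dk_sq]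
    _ ≤ 3 / 2 := by
        push_cast
        rw [div_mul_eq_mul_div, div_le_div_iff_of_pos_right (by norm_num), inv_mul_le_iff₀ hpos]
        linarith

/-- Fourier coefficients on the torus. -/
def fc (f : TT × TT → ℝ) (q : ℤ × ℤ) : ℂ := ∫ p, (f p : ℂ) * ee (-q) p ∂mu2

lemma int_mul_ee (f : TT × TT → ℝ) (hf : Integrable f mu2) (q : ℤ × ℤ) :
    Integrable (fun p => (f p : ℂ) * ee q p) mu2 := by
  have hf' : Integrable (fun p => (f p : ℂ)) mu2 := hf.ofReal
  refine hf'.mul_bdd (c := 1) (ee_cont q).aestronglyMeasurable ?_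
  exact Eventually.of_forall fun p => (norm_ee q p).le

lemma fc_neg (f : TT × TT → ℝ) (q : ℤ × ℤ) : fc f (-q) = (starRingEnd ℂ) (fc f q) := by
  unfold fc
  rw [← integral_conj]
  congr 1; ext p
  rw [map_mul, Complex.conj_ofReal, ← ee_neg]

/-- Two dimensional weights. -/
def K2 (N : ℕ) (q : ℤ × ℤ) : ℂ := ((kap N q.1 * kap N q.2 : ℝ) : ℂ)

lemma K2_neg (N : ℕ) (q : ℤ × ℤ) : K2 N (-q) = K2 N q := by
  unfold K2; rw [Prod.fst_neg, Prod.snd_neg, kap_neg, kap_neg]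

lemma K2_conj (N : ℕ) (q : ℤ × ℤ) : (starRingEnd ℂ) (K2 N q) = K2 N q := by
  unfold K2; rw [Complex.conj_ofReal]

lemma K2_one (N : ℕ) (q : ℤ × ℤ) (hq : q ∈ box N) : K2 N q = 1 := by
  rw [mem_box] at hq
  unfold K2; rw [kap_one N _ hq.1.1 hq.1.2, kap_one N _ hq.2.1 hq.2.2]; simp

/-- Coefficients of the regularized function. -/
def cK (N : ℕ) (f : TT × TT → ℝ) (q : ℤ × ℤ) : ℂ := K2 N q * fc f q

lemma cK_neg (N : ℕ) (f : TT × TT → ℝ) (q : ℤ × ℤ) :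
    cK N f (-q) = (starRingEnd ℂ) (cK N f q) := by
  unfold cK; rw [K2_neg, fc_neg, map_mul, K2_conj]

lemma sigma_eq (N : ℕ) (f : TT × TT → ℝ) (hf : Integrable f mu2) (p : TT × TT) :
    trig (box (3 * N)) (cK N f) p =
      ∫ z, (f z : ℂ) * (Vk N (p.1 - z.1) * Vk N (p.2 - z.2)) ∂mu2 := by
  have h1 : ∀ z : TT × TT, (f z : ℂ) * (Vk N (p.1 - z.1) * Vk N (p.2 - z.2)) =
      ∑ q ∈ box (3 * N), (K2 N q * ee q p) * ((f z : ℂ) * ee (-q) z) := by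
    intro z
    rw [Vk_eq, Vk_eq, Finset.sum_mul_sum, ← Finset.sum_product', Finset.mul_sum]
    apply Finset.sum_congr rfl
    intro q _
    rw [fourier_sub_arg, fourier_sub_arg, ee_neg]
    unfold K2 ee
    rw [map_mul]
    push_cast
    ring
  simp only [h1]
  rw [integral_finsetSum _ (fun q _ => (int_mul_ee f hf (-q)).const_mul _)]
  unfold trig
  apply Finset.sum_congr rfl
  intro q _
  rw [integral_const_mul]
  unfold cK fc
  ring

lemma sigma_le (N : ℕ) (f : TT × TT → ℝ) (hf : Integrable f mu2) (hb : ∀ p, |f p| ≤ 1)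
    (p : TT × TT) : ‖trig (box (3 * N)) (cK N f) p‖ ≤ 9 / 4 := by
  have hV := Vk_cont N
  rw [sigma_eq N f hf p]
  calc _ ≤ ∫ z, ‖Vk N (p.1 - z.1)‖ * ‖Vk N (p.2 - z.2)‖ ∂mu2 := by
        apply norm_integral_le_of_norm_le
        · exact cont_integrable2 _ (by fun_prop)
        · refine Eventually.of_forall fun z => ?_
          rw [norm_mul, norm_mul, Complex.norm_real, Real.norm_eq_abs]
          exact mul_le_of_le_one_left (by positivity) (hb z)
    _ = (∫ t, ‖Vk N (p.1 - t)‖ ∂mu) * ∫ t, ‖Vk N (p.2 - t)‖ ∂mu :=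
        integral_prod_mul (μ := mu) (ν := mu) (fun t => ‖Vk N (p.1 - t)‖) (fun t => ‖Vk N (p.2 - t)‖)
    _ = (∫ t, ‖Vk N t‖ ∂mu) * ∫ t, ‖Vk N t‖ ∂mu := by
        rw [integral_sub_left_eq_self (fun t => ‖Vk N t‖) mu p.1,
          integral_sub_left_eq_self (fun t => ‖Vk N t‖) mu p.2]
    _ ≤ 3 / 2 * (3 / 2) := by
        have h0 : 0 ≤ ∫ t, ‖Vk N t‖ ∂mu := integral_nonneg fun t => norm_nonneg _
        have := Vk_int N
        gcongr
    _ = 9 / 4 := by norm_num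

lemma int_trig (R : ℕ) (f : TT × TT → ℝ) (hf : Integrable f mu2) (c : ℤ × ℤ → ℂ) :
    ∫ p, (f p : ℂ) * trig (box R) c p ∂mu2 = ∑ q ∈ box R, c q * fc f (-q) := by
  have h1 : ∀ p, (f p : ℂ) * trig (box R) c p = ∑ q ∈ box R, c q * ((f p : ℂ) * ee q p) := by
    intro p; unfold trig; rw [Finset.mul_sum]
    apply Finset.sum_congr rfl
    intro q _; ring
  simp only [h1]
  rw [integral_finsetSum _ (fun q _ => (int_mul_ee f hf q).const_mul _)]
  apply Finset.sum_congr rfl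
  intro q _
  rw [integral_const_mul]; unfold fc; rw [neg_neg]

lemma duality (R : ℕ) (f φ : TT × TT → ℝ) (hf : Integrable f mu2) (hφ : Integrable φ mu2)
    (w : ℤ × ℤ → ℂ) :
    ∫ p, (φ p : ℂ) * trig (box R) (fun q => w q * fc f q) p ∂mu2 =
      ∫ p, (f p : ℂ) * trig (box R) (fun q => w (-q) * fc φ q) p ∂mu2 := by
  rw [int_trig R φ hφ, int_trig R f hf, ← sum_box_neg]
  apply Finset.sum_congr rfl
  intro q _
  rw [neg_neg]; ring

lemma sign_facts (h : TT × TT → ℝ) (hh : Continuous h) :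
    ∃ φ : TT × TT → ℝ, Integrable φ mu2 ∧ (∀ p, |φ p| ≤ 1) ∧ ∀ p, φ p * h p = |h p| := by
  have hm : Measurable fun p => if 0 ≤ h p then (1 : ℝ) else -1 :=
    Measurable.ite (measurableSet_le measurable_const hh.measurable) measurable_const
      measurable_const
  have hb : ∀ p, |(if 0 ≤ h p then (1 : ℝ) else -1)| ≤ 1 := by
    intro p; split_ifs <;> simp
  refine ⟨fun p => if 0 ≤ h p then 1 else -1, ?_, hb, ?_⟩
  · exact Integrable.of_bound hm.aestronglyMeasurable 1 (Eventually.of_forall fun p => hb p)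
  · intro p
    simp only []
    split_ifs with h0
    · rw [abs_of_nonneg h0, one_mul]
    · rw [abs_of_neg (not_le.1 h0)]; ring

lemma int_mul_trig (R : ℕ) (f : TT × TT → ℝ) (hf : Integrable f mu2) (c : ℤ × ℤ → ℂ) :
    Integrable (fun p => (f p : ℂ) * trig (box R) c p) mu2 := by
  have hf' : Integrable (fun p => (f p : ℂ)) mu2 := hf.ofReal
  refine hf'.mul_bdd (c := ∑ q ∈ box R, ‖c q‖) (trig_cont _ _).aestronglyMeasurable ?_
  refine Eventually.of_forall fun p => ?_
  unfold trig
  refine (norm_sum_le _ _).trans (le_of_eq (Finset.sum_congr rfl fun q _ => ?_))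
  rw [norm_mul, norm_ee, mul_one]

lemma zyg (ε : ℤ) (N : ℕ) (f : TT × TT → ℝ) (hf : Integrable f mu2)
    (hfl : Integrable (fun p => |f p| * logPlus |f p|) mu2) :
    ∫ p, ‖trig (box (3 * N)) (fun q => sg ε q * cK N f q) p‖ ∂mu2 ≤
      9 / 4 * (∫ p, |f p| * logPlus |f p| ∂mu2 + 4) := by
  set g := trig (box (3 * N)) (fun q => sg ε q * cK N f q) with hg
  have hgc : Continuous g := trig_cont _ _
  have hre : ∀ p, (g p).re = 0 := trig_re_eq_zero _ _ (by
    intro q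
    rw [sg_neg, cK_neg, map_mul, sg_conj]; ring)
  obtain ⟨φ, hφi, hφb, hφ⟩ := sign_facts (fun p => (g p).im) (by fun_prop)
  set ψ : TT × TT → ℂ := trig (box (3 * N)) (fun q => sg ε q * ((4 / 9 : ℝ) * cK N φ q)) with hψ
  have hψc : Continuous ψ := trig_cont _ _
  have hexp : ∫ p, Real.exp |(ψ p).im| ∂mu2 ≤ 4 := by
    refine exp_int ε (3 * N) (fun q => (4 / 9 : ℝ) * cK N φ q) ?_ ?_
    · intro q; rw [cK_neg, map_mul, Complex.conj_ofReal]
    · intro p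
      have h1 : trig (box (3 * N)) (fun q => (4 / 9 : ℝ) * cK N φ q) p =
          (4 / 9 : ℝ) * trig (box (3 * N)) (cK N φ) p := by
        unfold trig; rw [Finset.mul_sum]
        apply Finset.sum_congr rfl
        intro q _; ring
      rw [h1, norm_mul, Complex.norm_real, Real.norm_of_nonneg (by norm_num)]
      linarith [sigma_le N φ hφi hφb p]
  have hdual : ∫ p, (φ p : ℂ) * g p ∂mu2 = ∫ p, (f p : ℂ) * (-(9 / 4 : ℝ) * ψ p) ∂mu2 := by
    have h1 := duality (3 * N) f φ hf hφi (fun q => sg ε q * K2 N q)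
    rw [hg]
    simp only [cK]
    simp only [mul_assoc] at h1
    rw [h1]
    congr 1; ext p
    congr 1
    rw [hψ]
    unfold trig; rw [Finset.mul_sum]
    apply Finset.sum_congr rfl
    intro q _
    simp only [sg_neg, K2_neg, cK]
    push_cast; ring
  have hψi : Integrable (fun p => (f p : ℂ) * (-(9 / 4 : ℝ) * ψ p)) mu2 := by
    have := (int_mul_trig (3 * N) f hf
      (fun q => sg ε q * ((4 / 9 : ℝ) * cK N φ q))).const_mul (-(9 / 4 : ℝ) : ℂ)
    refine this.congr (Eventually.of_forall fun p => ?_)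
    simp only [hψ]; ring
  have hei : Integrable (fun p => Real.exp |(ψ p).im|) mu2 := cont_integrable2 _ (by fun_prop)
  calc ∫ p, ‖g p‖ ∂mu2 = ∫ p, RCLike.im ((φ p : ℂ) * g p) ∂mu2 := by
        congr 1; ext p
        have h1 : RCLike.im ((φ p : ℂ) * g p) = φ p * (g p).im := by
          change ((φ p : ℂ) * g p).im = _
          simp
        rw [h1, hφ p]
        have h2 : g p = ((g p).im : ℂ) * Complex.I := by
          apply Complex.ext
          · simp [hre p]
          · simp
        conv_lhs => rw [h2]
        rw [norm_mul, Complex.norm_I, mul_one, Complex.norm_real, Real.norm_eq_abs]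
    _ = (∫ p, (φ p : ℂ) * g p ∂mu2).im := integral_im (int_mul_trig _ φ hφi _)
    _ = ∫ p, RCLike.im ((f p : ℂ) * (-(9 / 4 : ℝ) * ψ p)) ∂mu2 := by
        rw [hdual]; exact (integral_im hψi).symm
    _ ≤ ∫ p, 9 / 4 * (|f p| * logPlus |f p| + Real.exp |(ψ p).im|) ∂mu2 := by
        apply integral_mono hψi.im ((hfl.add hei).const_mul _)
        intro p
        have h1 : RCLike.im ((f p : ℂ) * (-(9 / 4 : ℝ) * ψ p)) = -(9 / 4) * (f p * (ψ p).im) := by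
          change ((f p : ℂ) * (-(9 / 4 : ℝ) * ψ p)).im = _
          simp; ring
        simp only [h1, Pi.add_apply]
        have h2 := young_log |f p| |(ψ p).im| (abs_nonneg _)
        have h3 := neg_abs_le (f p * (ψ p).im)
        rw [abs_mul] at h3
        linarith
    _ = 9 / 4 * (∫ p, |f p| * logPlus |f p| ∂mu2 + ∫ p, Real.exp |(ψ p).im| ∂mu2) := by
        rw [integral_const_mul, integral_add hfl hei]
    _ ≤ _ := by linarith

lemma l1_sigma (N : ℕ) (f : TT × TT → ℝ) (hf : Integrable f mu2)
    (hfl : Integrable (fun p => |f p| * logPlus |f p|) mu2) :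
    ∫ p, |(trig (box (3 * N)) (cK N f) p).re| ∂mu2 ≤
      9 / 4 * (∫ p, |f p| * logPlus |f p| ∂mu2 + 4) := by
  set g := trig (box (3 * N)) (cK N f) with hg
  have hgc : Continuous g := trig_cont _ _
  obtain ⟨φ, hφi, hφb, hφ⟩ := sign_facts (fun p => (g p).re) (by fun_prop)
  have hdual : ∫ p, (φ p : ℂ) * g p ∂mu2 =
      ∫ p, (f p : ℂ) * trig (box (3 * N)) (cK N φ) p ∂mu2 := by
    have h1 := duality (3 * N) f φ hf hφi (fun q => K2 N q)
    simp only [K2_neg] at h1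
    exact h1
  have hψi := int_mul_trig (3 * N) f hf (cK N φ)
  calc ∫ p, |(g p).re| ∂mu2 = ∫ p, RCLike.re ((φ p : ℂ) * g p) ∂mu2 := by
        congr 1; ext p
        have h1 : RCLike.re ((φ p : ℂ) * g p) = φ p * (g p).re := by
          change ((φ p : ℂ) * g p).re = _
          simp
        rw [h1, hφ p]
    _ = (∫ p, (φ p : ℂ) * g p ∂mu2).re := integral_re (int_mul_trig _ φ hφi _)
    _ = ∫ p, RCLike.re ((f p : ℂ) * trig (box (3 * N)) (cK N φ) p) ∂mu2 := by
        rw [hdual]; exact (integral_re hψi).symm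
    _ ≤ ∫ p, 9 / 4 * (|f p| * logPlus |f p| + 4) ∂mu2 := by
        apply integral_mono hψi.re ((hfl.add (integrable_const _)).const_mul _)
        intro p
        have h1 : RCLike.re ((f p : ℂ) * trig (box (3 * N)) (cK N φ) p) =
            f p * (trig (box (3 * N)) (cK N φ) p).re := by
          change ((f p : ℂ) * trig (box (3 * N)) (cK N φ) p).re = _
          simp
        simp only [h1, Pi.add_apply]
        have h2 := young_log |f p| 1 (abs_nonneg _)
        have h3 := le_abs_self (f p * (trig (box (3 * N)) (cK N φ) p).re)
        rw [abs_mul] at h3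
        have h4 := (Complex.abs_re_le_norm _).trans (sigma_le N φ hφi hφb p)
        have h5 : |f p| * |(trig (box (3 * N)) (cK N φ) p).re| ≤ |f p| * (9 / 4) := by gcongr
        have h6 := Real.exp_one_lt_d9
        linarith
    _ = _ := by
        rw [integral_const_mul, integral_add hfl (integrable_const _)]
        simp


/-! ### Part 10: reduction of square partial sums to one dimensional ones -/

/-- Truncated sign. -/
def bt (n : ℕ) (m : ℤ) : ℂ := if m.natAbs ≤ n then (m.sign : ℂ) else 0

lemma sq_identity (n : ℕ) (q : ℤ × ℤ) :
    (if sqi q ≤ n then (1 : ℂ) else 0) = (if q = 0 then 1 else 0) +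
      bt n q.1 * ((sg 1 q + sg (-1) q) / 2) + bt n q.2 * ((sg 1 q - sg (-1) q) / 2) := by
  obtain ⟨m, k⟩ := q
  have h0 : ((m, k) : ℤ × ℤ) = 0 ↔ m = 0 ∧ k = 0 := by
    rw [Prod.ext_iff]; simp
  have hs : ∀ j : ℤ, (0 < j ∧ (j.sign : ℂ) = 1) ∨ (j = 0 ∧ (j.sign : ℂ) = 0) ∨
      (j < 0 ∧ (j.sign : ℂ) = -1) := by
    intro j
    rcases lt_trichotomy j 0 with h | h | h
    · right; right; exact ⟨h, by rw [Int.sign_eq_neg_one_of_neg h]; simp⟩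
    · right; left; exact ⟨h, by rw [h]; simp⟩
    · left; exact ⟨h, by rw [Int.sign_eq_one_of_pos h]; simp⟩
  have hm := hs m
  have hk := hs k
  have h1 := hs (m + 1 * k)
  have h2 := hs (m + -1 * k)
  unfold sqi bt sg
  simp only [h0, max_le_iff]
  generalize (m.sign : ℂ) = a at *
  generalize (k.sign : ℂ) = b at *
  generalize ((m + 1 * k).sign : ℂ) = c at *
  generalize ((m + -1 * k).sign : ℂ) = d at *
  rcases hm with ⟨hm, rfl⟩ | ⟨hm, rfl⟩ | ⟨hm, rfl⟩ <;>
  rcases hk with ⟨hk, rfl⟩ | ⟨hk, rfl⟩ | ⟨hk, rfl⟩ <;>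
  rcases h1 with ⟨h1, rfl⟩ | ⟨h1, rfl⟩ | ⟨h1, rfl⟩ <;>
  first
  | (exfalso; omega)
  | (rcases h2 with ⟨h2, rfl⟩ | ⟨h2, rfl⟩ | ⟨h2, rfl⟩ <;>
     first
     | (exfalso; omega)
     | (split_ifs <;> first
        | (exfalso; omega)
        | norm_num))

lemma PS_trig (R : ℕ) (d : ℤ × ℤ → ℂ) (n : ℕ) (p : TT × TT) :
    PS (trig (box R) d) n p =
      trig (box R) (fun q => if 1 ≤ q.1 ∧ q.1 ≤ n then d q else 0) p := by
  unfold PS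
  have h1 : ∀ z, trig (box R) d (z, p.2) * En n (p.1 - z) = ∑ q ∈ box R, ∑ m ∈ Finset.range n,
      (d q * fourier q.2 p.2 * fourier ((m : ℤ) + 1) p.1) * fourier (q.1 - ((m : ℤ) + 1)) z := by
    intro z
    unfold trig En
    rw [Finset.sum_mul_sum]
    apply Finset.sum_congr rfl
    intro q _
    apply Finset.sum_congr rfl
    intro m _
    rw [fourier_sub_arg, sub_eq_add_neg q.1, fourier_add (m := q.1), fourier_neg]
    unfold ee
    ring
  simp only [h1]
  rw [integral_finsetSum _ (fun q _ => cont_integrable _ (by fun_prop))]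
  unfold trig
  apply Finset.sum_congr rfl
  intro q _
  rw [integral_finsetSum _ (fun m _ => cont_integrable _ (by fun_prop))]
  simp only [integral_const_mul, integral_fourier]
  by_cases h : 1 ≤ q.1 ∧ q.1 ≤ n
  · rw [if_pos h]
    obtain ⟨m, hm⟩ : ∃ m : ℕ, q.1 = (m : ℤ) + 1 := ⟨(q.1 - 1).toNat, by omega⟩
    rw [Finset.sum_eq_single_of_mem m (by rw [Finset.mem_range]; omega)]
    · rw [if_pos (by omega)]
      unfold ee
      rw [hm]; ring
    · intro j _ hj
      rw [if_neg (by omega), mul_zero]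
  · rw [if_neg h, zero_mul]
    apply Finset.sum_eq_zero
    intro j hj
    rw [Finset.mem_range] at hj
    rw [if_neg (by omega), mul_zero]

lemma PS_diff (R : ℕ) (d : ℤ × ℤ → ℂ) (n : ℕ) (p : TT × TT) :
    PS (trig (box R) d) n p -
      (starRingEnd ℂ) (PS (trig (box R) (fun q => (starRingEnd ℂ) (d (-q)))) n p) =
      trig (box R) (fun q => bt n q.1 * d q) p := by
  rw [PS_trig, PS_trig, trig_conj]
  unfold trig
  rw [← Finset.sum_sub_distrib]
  apply Finset.sum_congr rfl
  intro q _
  rw [← sub_mul]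
  congr 1
  simp only [Prod.fst_neg, neg_neg]
  unfold bt
  rcases lt_trichotomy q.1 0 with h | h | h
  · rw [Int.sign_eq_neg_one_of_neg h, if_neg (by omega)]
    by_cases h2 : q.1.natAbs ≤ n
    · rw [if_pos h2, if_pos (by omega)]; simp
    · rw [if_neg h2, if_neg (by omega)]; simp
  · rw [h]; simp
  · rw [Int.sign_eq_one_of_pos h]
    rw [if_neg (show ¬ (1 ≤ -q.1 ∧ -q.1 ≤ n) by omega)]
    by_cases h2 : q.1.natAbs ≤ n
    · rw [if_pos h2, if_pos (by omega)]; simp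
    · rw [if_neg h2, if_neg (by omega)]; simp

lemma trig_swap (R : ℕ) (d : ℤ × ℤ → ℂ) (p : TT × TT) :
    trig (box R) (fun q => d q.swap) p.swap = trig (box R) d p := by
  unfold trig
  refine Finset.sum_bij' (fun q _ => q.swap) (fun q _ => q.swap) ?_ ?_ ?_ ?_ ?_
  · intro q hq; rw [mem_box] at hq ⊢; exact ⟨hq.2, hq.1⟩
  · intro q hq; rw [mem_box] at hq ⊢; exact ⟨hq.2, hq.1⟩
  · intro q _; simp
  · intro q _; simp
  · intro q _
    congr 1
    unfold ee
    simp only [Prod.fst_swap, Prod.snd_swap]; ring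

/-- Oscillation control for a truncated trigonometric polynomial. -/
lemma bad_set2 (R : ℕ) (d : ℤ × ℤ → ℂ) (Z : ℝ)
    (hZ : ∫ p, ‖trig (box R) d p‖ ∂mu2 ≤ Z) (lam : ℝ) (hlam : 0 < lam) :
    ∃ Bad : Set (TT × TT), MeasurableSet Bad ∧ mu2 Bad ≤ ENNReal.ofReal (26 * Z / lam) ∧
      ∀ p ∉ Bad, ∀ a N : ℕ, 0 < N → ∃ c : ℂ, ∑ i ∈ Finset.range N,
        ‖trig (box R) (fun q => bt (a + i) q.1 * d q) p - c‖ ≤ 1200 * lam * N := by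
  have hc := trig_cont (box R) d
  set d' : ℤ × ℤ → ℂ := fun q => (starRingEnd ℂ) (d (-q)) with hd'
  have hc' := trig_cont (box R) d'
  have hZ0 : 0 ≤ Z := le_trans (integral_nonneg fun p => norm_nonneg _) hZ
  have hl : ∫⁻ p, ‖trig (box R) d p‖ₑ ∂mu2 ≤ ENNReal.ofReal Z := by
    rw [← ofReal_integral_norm_eq_lintegral_enorm (cont_integrable2 _ hc)]
    exact ENNReal.ofReal_le_ofReal hZ
  have hl' : ∫⁻ p, ‖trig (box R) d' p‖ₑ ∂mu2 ≤ ENNReal.ofReal Z := by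
    refine le_trans (le_of_eq ?_) hl
    congr 1; ext p
    rw [hd', ← trig_conj]
    rw [← ofReal_norm, ← ofReal_norm, RCLike.norm_conj]
  obtain ⟨B1, hB1, hm1, hB1'⟩ := bad_set _ hc lam hlam
  obtain ⟨B2, hB2, hm2, hB2'⟩ := bad_set _ hc' lam hlam
  have hb : ENNReal.ofReal (13 / lam) * ENNReal.ofReal Z = ENNReal.ofReal (13 * Z / lam) := by
    rw [← ENNReal.ofReal_mul (by positivity)]; congr 1; ring
  refine ⟨B1 ∪ B2, hB1.union hB2, ?_, ?_⟩
  · calc mu2 (B1 ∪ B2) ≤ mu2 B1 + mu2 B2 := measure_union_le _ _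
      _ ≤ ENNReal.ofReal (13 * Z / lam) + ENNReal.ofReal (13 * Z / lam) := by
          rw [← hb]
          refine add_le_add (hm1.trans ?_) (hm2.trans ?_)
          · gcongr
          · gcongr
      _ = _ := by
          rw [← ENNReal.ofReal_add (by positivity) (by positivity)]; congr 1; ring
  · intro p hp a N hN
    rw [Set.mem_union, not_or] at hp
    obtain ⟨c1, h1⟩ := hB1' p hp.1 a N hN
    obtain ⟨c2, h2⟩ := hB2' p hp.2 a N hN
    refine ⟨c1 - (starRingEnd ℂ) c2, ?_⟩
    calc _ ≤ ∑ i ∈ Finset.range N, (‖PS (trig (box R) d) (a + i) p - c1‖ +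
          ‖PS (trig (box R) d') (a + i) p - c2‖) := by
          apply Finset.sum_le_sum
          intro i _
          rw [← PS_diff]
          rw [show PS (trig (box R) d) (a + i) p -
            (starRingEnd ℂ) (PS (trig (box R) d') (a + i) p) - (c1 - (starRingEnd ℂ) c2) =
            (PS (trig (box R) d) (a + i) p - c1) -
            (starRingEnd ℂ) (PS (trig (box R) d') (a + i) p - c2) by rw [map_sub]; ring]
          refine (norm_sub_le _ _).trans ?_
          rw [RCLike.norm_conj]
      _ ≤ _ := by rw [Finset.sum_add_distrib]; linarith

lemma swap_mp : MeasurePreserving (Prod.swap : TT × TT → TT × TT) mu2 mu2 :=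
  Measure.measurePreserving_swap

lemma sqPS_split (R : ℕ) (c : ℤ × ℤ → ℂ) (n : ℕ) (p : TT × TT) :
    sqPS (box R) c n p = (c 0 +
      trig (box R) (fun q => bt n q.1 * ((sg 1 q + sg (-1) q) / 2 * c q)) p +
      trig (box R) (fun q => bt n q.1 * ((sg 1 q.swap - sg (-1) q.swap) / 2 * c q.swap)) p.swap).re := by
  unfold sqPS
  congr 1
  have h1 := trig_swap R (fun q => bt n q.2 * ((sg 1 q - sg (-1) q) / 2 * c q)) p
  simp only [Prod.snd_swap] at h1
  rw [h1]
  have h0 : (0 : ℤ × ℤ) ∈ box R := by rw [mem_box]; simp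
  have h2 : c 0 = ∑ q ∈ box R, (if q = 0 then (1 : ℂ) else 0) * c q * ee q p := by
    rw [Finset.sum_eq_single_of_mem 0 h0]
    · simp [ee]
    · intro q _ hq; rw [if_neg hq]; ring
  rw [h2]
  unfold trig
  rw [Finset.sum_filter, ← Finset.sum_add_distrib, ← Finset.sum_add_distrib]
  apply Finset.sum_congr rfl
  intro q _
  have h3 := sq_identity n q
  have h4 : (if sqi q ≤ n then c q * ee q p else 0) =
      (if sqi q ≤ n then (1 : ℂ) else 0) * (c q * ee q p) := by split_ifs <;> simp
  rw [h4, h3]; ring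

/-- Square partial sums on the torus. -/
def SQ (f : TT × TT → ℝ) (k : ℕ) (p : TT × TT) : ℝ := (trig (box k) (fc f) p).re

lemma sqPS_eq_SQ (N k : ℕ) (hk : k ≤ N) (f : TT × TT → ℝ) (p : TT × TT) :
    sqPS (box (3 * N)) (cK N f) k p = SQ f k p := by
  unfold sqPS SQ trig
  congr 1
  have hset : (box (3 * N)).filter (fun q => sqi q ≤ k) = box k := by
    ext q
    rw [Finset.mem_filter, mem_box, mem_box]
    unfold sqi
    rw [max_le_iff]
    push_cast
    omega
  rw [hset]
  apply Finset.sum_congr rfl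
  intro q hq
  unfold cK
  rw [K2_one, one_mul]
  rw [mem_box] at hq ⊢
  omega

lemma stepFun_congr (ξ η : ℕ → ℝ) (n : ℕ) (h : ∀ k ≤ n, ξ k = η k) : stepFun ξ n = stepFun η n := by
  ext t
  unfold stepFun
  apply Finset.sum_congr rfl
  intro k hk
  rw [h k (by rw [Finset.mem_range] at hk; omega)]

lemma final_N (f : TT × TT → ℝ) (hf : Integrable f mu2)
    (hfl : Integrable (fun p => |f p| * logPlus |f p|) mu2) (N : ℕ) (lam : ℝ) (hlam : 0 < lam) :
    ∃ Bad : Set (TT × TT), MeasurableSet Bad ∧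
      mu2 Bad ≤ ENNReal.ofReal (120 * (∫ p, |f p| * logPlus |f p| ∂mu2 + 4) / lam) ∧
      ∀ p ∉ Bad, ∀ n ≤ N, bmoNorm (stepFun (fun k => SQ f k p) n) ≤ 91202 * lam := by
  set L := ∫ p, |f p| * logPlus |f p| ∂mu2 with hL
  have hL0 : 0 ≤ L := integral_nonneg fun p => mul_nonneg (abs_nonneg _) (logPlus_nonneg _)
  set Z := 9 / 4 * (L + 4) with hZ
  have hZ0 : 0 ≤ Z := by positivity
  set c := cK N f with hc
  set R := 3 * N with hR
  have hzp := zyg 1 N f hf hfl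
  have hzm := zyg (-1) N f hf hfl
  have hcp := trig_cont (box R) (fun q => sg 1 q * c q)
  have hcm := trig_cont (box R) (fun q => sg (-1) q * c q)
  have hip := cont_integrable2 _ hcp.norm
  have him := cont_integrable2 _ hcm.norm
  have key : ∀ s : ℂ, ‖s‖ = 1 →
      ∫ p, ‖trig (box R) (fun q => (sg 1 q + s * sg (-1) q) / 2 * c q) p‖ ∂mu2 ≤ Z := by
    intro s hs
    calc _ ≤ ∫ p, (1 / 2 * ‖trig (box R) (fun q => sg 1 q * c q) p‖ +
          1 / 2 * ‖trig (box R) (fun q => sg (-1) q * c q) p‖) ∂mu2 := by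
          apply integral_mono (cont_integrable2 _ (trig_cont _ _).norm)
            ((hip.const_mul _).add (him.const_mul _))
          intro p
          have : trig (box R) (fun q => (sg 1 q + s * sg (-1) q) / 2 * c q) p =
              (1 / 2) * trig (box R) (fun q => sg 1 q * c q) p +
              (s / 2) * trig (box R) (fun q => sg (-1) q * c q) p := by
            unfold trig
            rw [Finset.mul_sum, Finset.mul_sum, ← Finset.sum_add_distrib]
            apply Finset.sum_congr rfl
            intro q _; ring
          simp only [this, Pi.add_apply]
          refine (norm_add_le _ _).trans ?_
          rw [norm_mul, norm_mul, norm_div, norm_div, hs]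
          simp
      _ = 1 / 2 * ∫ p, ‖trig (box R) (fun q => sg 1 q * c q) p‖ ∂mu2 +
          1 / 2 * ∫ p, ‖trig (box R) (fun q => sg (-1) q * c q) p‖ ∂mu2 := by
          rw [integral_add (hip.const_mul _) (him.const_mul _), integral_const_mul,
            integral_const_mul]
      _ ≤ Z := by linarith
  have ka := key 1 (by simp)
  have kb := key (-1) (by simp)
  simp only [one_mul, neg_one_mul, ← sub_eq_add_neg] at ka kb
  have kb' : ∫ p, ‖trig (box R)
      (fun q => (sg 1 q.swap - sg (-1) q.swap) / 2 * c q.swap) p‖ ∂mu2 ≤ Z := by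
    refine le_trans (le_of_eq ?_) kb
    rw [← swap_mp.integral_comp (MeasurableEquiv.prodComm.measurableEmbedding)
      (fun p => ‖trig (box R) (fun q => (sg 1 q.swap - sg (-1) q.swap) / 2 * c q.swap) p‖)]
    congr 1; ext p
    rw [trig_swap R (fun q => (sg 1 q - sg (-1) q) / 2 * c q) p]
  obtain ⟨B1, hB1, hm1, hB1'⟩ := bad_set2 R _ Z ka lam hlam
  obtain ⟨B2, hB2, hm2, hB2'⟩ := bad_set2 R _ Z kb' lam hlam
  obtain ⟨A, hA, hmA, hA'⟩ := mean_bound (box R) c N lam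
  have hl1 := l1_sigma N f hf hfl
  have hmA' : mu2 A ≤ ENNReal.ofReal (Z / lam) := by
    rw [← ofReal_measureReal (measure_ne_top _ _)]
    apply ENNReal.ofReal_le_ofReal
    rw [le_div_iff₀ hlam, mul_comm _ lam]
    exact hmA.trans hl1
  refine ⟨B1 ∪ Prod.swap ⁻¹' B2 ∪ A, (hB1.union (swap_mp.measurable hB2)).union hA, ?_, ?_⟩
  · calc mu2 (B1 ∪ Prod.swap ⁻¹' B2 ∪ A)
        ≤ mu2 B1 + mu2 (Prod.swap ⁻¹' B2) + mu2 A :=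
          (measure_union_le _ _).trans (add_le_add (measure_union_le _ _) le_rfl)
      _ ≤ ENNReal.ofReal (26 * Z / lam) + ENNReal.ofReal (26 * Z / lam) +
          ENNReal.ofReal (Z / lam) := by
          rw [swap_mp.measure_preimage hB2.nullMeasurableSet]
          exact add_le_add (add_le_add hm1 hm2) hmA'
      _ ≤ _ := by
          rw [← ENNReal.ofReal_add (by positivity) (by positivity),
            ← ENNReal.ofReal_add (by positivity) (by positivity)]
          apply ENNReal.ofReal_le_ofReal
          rw [← add_div, ← add_div, div_le_div_iff_of_pos_right hlam, hZ]
          linarith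
  · intro p hp n hn
    simp only [Set.mem_union, not_or, Set.mem_preimage] at hp
    obtain ⟨⟨hp1, hp2⟩, hpA⟩ := hp
    have hosc : OscLe (fun k => sqPS (box R) c k p) (2400 * lam) := by
      intro a M hM
      obtain ⟨c1, h1⟩ := hB1' p hp1 a M hM
      obtain ⟨c2, h2⟩ := hB2' p.swap hp2 a M hM
      refine ⟨(c 0 + c1 + c2).re, ?_⟩
      calc _ ≤ ∑ i ∈ Finset.range M, (‖trig (box R) (fun q => bt (a + i) q.1 *
              ((sg 1 q + sg (-1) q) / 2 * c q)) p - c1‖ +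
            ‖trig (box R) (fun q => bt (a + i) q.1 *
              ((sg 1 q.swap - sg (-1) q.swap) / 2 * c q.swap)) p.swap - c2‖) := by
            apply Finset.sum_le_sum
            intro i _
            beta_reduce
            rw [sqPS_split, ← Complex.sub_re]
            refine (Complex.abs_re_le_norm _).trans ?_
            refine le_trans (le_of_eq ?_) (norm_add_le _ _)
            congr 1; ring
        _ ≤ _ := by rw [Finset.sum_add_distrib]; linarith
    have hmean := hA' p hpA _ hosc n hn
    have hfin := bmoNorm_stepFun_le _ _ _ hosc n hmean
    rw [stepFun_congr (fun k => SQ f k p) (fun k => sqPS (box R) c k p) n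
      (fun k hk => (sqPS_eq_SQ N k (hk.trans hn) f p).symm)]
    linarith


/-! ### Part 11: transfer to the fundamental domain and conclusion -/

/-- Projection of the plane to the torus. -/
def prj (p : ℝ × ℝ) : TT × TT := ((p.1 : TT), (p.2 : TT))

/-- Lift of a function to the torus. -/
def lft (f : ℝ × ℝ → ℝ) (p : TT × TT) : ℝ :=
  f ((AddCircle.measurableEquivIco (2 * Real.pi) (-Real.pi) p.1 : ℝ),
    (AddCircle.measurableEquivIco (2 * Real.pi) (-Real.pi) p.2 : ℝ))

lemma lft_measurable (f : ℝ × ℝ → ℝ) (hf : Measurable f) : Measurable (lft f) := by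
  unfold lft
  fun_prop

lemma ico_coe (x : ℝ) (hx : x ∈ T1) :
    (AddCircle.measurableEquivIco (2 * Real.pi) (-Real.pi) (x : TT) : ℝ) = x := by
  have hx' : x ∈ Set.Ico (-Real.pi) (-Real.pi + 2 * Real.pi) := by
    unfold T1 at hx; constructor
    · exact hx.1
    · linarith [hx.2]
  have : (AddCircle.equivIco (2 * Real.pi) (-Real.pi) (x : TT)) = ⟨x, hx'⟩ := by
    rw [Equiv.apply_eq_iff_eq_symm_apply]; rfl
  exact congrArg Subtype.val this

lemma lft_prj (f : ℝ × ℝ → ℝ) (p : ℝ × ℝ) (hp : p ∈ T2) : lft f (prj p) = f p := by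
  unfold lft prj
  simp only []
  rw [ico_coe _ hp.1, ico_coe _ hp.2]

lemma mk_mp : MeasurePreserving (fun x : ℝ => (x : TT)) (volume.restrict T1) volume := by
  have h := AddCircle.measurePreserving_mk (2 * Real.pi) (-Real.pi)
  have h2 : volume.restrict (Set.Ioc (-Real.pi) (-Real.pi + 2 * Real.pi)) = volume.restrict T1 := by
    unfold T1
    rw [show -Real.pi + 2 * Real.pi = Real.pi by ring]
    exact (Measure.restrict_congr_set Ico_ae_eq_Ioc).symm
  rw [h2] at h
  exact h

lemma prj_mp : MeasurePreserving prj (volume.restrict T2)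
    ((volume : Measure TT).prod (volume : Measure TT)) := by
  have h := mk_mp.prod mk_mp
  rw [Measure.prod_restrict] at h
  exact h

lemma vol_mu2 : (volume : Measure TT).prod (volume : Measure TT) =
    ENNReal.ofReal (4 * Real.pi ^ 2) • mu2 := by
  rw [AddCircle.volume_eq_smul_haarAddCircle, Measure.prod_smul_left, Measure.prod_smul_right,
    smul_smul, ← ENNReal.ofReal_mul (by positivity)]
  congr 2; ring

lemma int_transfer {E : Type*} [NormedAddCommGroup E] [NormedSpace ℝ E] (h : TT × TT → E)
    (hh : AEStronglyMeasurable h mu2) :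
    ∫ p in T2, h (prj p) = (4 * Real.pi ^ 2) • ∫ p, h p ∂mu2 := by
  have h1 : AEStronglyMeasurable h (Measure.map prj (volume.restrict T2)) := by
    rw [prj_mp.map_eq, vol_mu2]
    exact hh.smul_measure _
  rw [← integral_map prj_mp.measurable.aemeasurable h1, prj_mp.map_eq, vol_mu2,
    integral_smul_measure, ENNReal.toReal_ofReal (by positivity)]

lemma integrable_transfer (h : TT × TT → ℝ) (hh : Measurable h)
    (hi : IntegrableOn (fun p => h (prj p)) T2) : Integrable h mu2 := by
  have h1 : Integrable h ((volume : Measure TT).prod (volume : Measure TT)) :=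
    (prj_mp.integrable_comp hh.aestronglyMeasurable).1 hi
  rw [vol_mu2] at h1
  rwa [integrable_smul_measure] at h1
  · rw [Ne, ENNReal.ofReal_eq_zero, not_le]; positivity
  · exact ENNReal.ofReal_ne_top

lemma T2_meas : MeasurableSet T2 := measurableSet_Ico.prod measurableSet_Ico

lemma fourier_real (m : ℤ) (x : ℝ) :
    fourier m (x : TT) = Complex.exp (Complex.I * ((m : ℂ) * (x : ℂ))) := by
  rw [fourier_coe_apply]
  congr 1
  push_cast
  have : (Real.pi : ℂ) ≠ 0 := by exact_mod_cast Real.pi_ne_zero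
  field_simp

lemma ee_prj (q : ℤ × ℤ) (p : ℝ × ℝ) :
    ee q (prj p) = Complex.exp (Complex.I * ((q.1 : ℂ) * (p.1 : ℂ) + (q.2 : ℂ) * (p.2 : ℂ))) := by
  unfold ee prj
  simp only []
  rw [fourier_real, fourier_real, ← Complex.exp_add]
  congr 1; ring

lemma coef_transfer (f : ℝ × ℝ → ℝ) (hf : Measurable f) (m k : ℤ) :
    fourierCoef2 f m k = fc (lft f) (m, k) := by
  unfold fourierCoef2 fc
  have hm : AEStronglyMeasurable (fun p => (lft f p : ℂ) * ee (-(m, k)) p) mu2 := by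
    refine AEStronglyMeasurable.mul ?_ (ee_cont _).aestronglyMeasurable
    exact (Complex.measurable_ofReal.comp (lft_measurable f hf)).aestronglyMeasurable
  have h := int_transfer _ hm
  have h2 : ∫ p in T2, (lft f (prj p) : ℂ) * ee (-(m, k)) (prj p) =
      ∫ p in T2, (f p : ℂ) *
        Complex.exp (-Complex.I * ((m : ℂ) * (p.1 : ℂ) + (k : ℂ) * (p.2 : ℂ))) := by
    apply setIntegral_congr_fun T2_meas
    intro p hp
    simp only []
    rw [lft_prj f p hp, ee_prj]
    congr 2
    simp only [Prod.fst_neg, Prod.snd_neg]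
    push_cast; ring
  rw [← h2, h]
  have : (Real.pi : ℂ) ≠ 0 := by exact_mod_cast Real.pi_ne_zero
  rw [Complex.real_smul]
  push_cast
  field_simp

lemma Snn_transfer (f : ℝ × ℝ → ℝ) (hf : Measurable f) (n : ℕ) (p : ℝ × ℝ) :
    Snn f n p.1 p.2 = SQ (lft f) n (prj p) := by
  unfold Snn SQ trig box
  congr 1
  rw [Finset.sum_product]
  apply Finset.sum_congr rfl
  intro m _
  apply Finset.sum_congr rfl
  intro k _
  rw [coef_transfer f hf, ee_prj]

lemma final_torus (f : TT × TT → ℝ) (hf : Integrable f mu2)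
    (hfl : Integrable (fun p => |f p| * logPlus |f p|) mu2) (lam : ℝ) (hlam : 0 < lam) :
    mu2 {p | lam < bmoSeq (fun n => SQ f n p)} ≤
      ENNReal.ofReal (120 * (∫ p, |f p| * logPlus |f p| ∂mu2 + 4) / (lam / 91202)) := by
  set E : ℕ → Set (TT × TT) := fun N =>
    {p | ∃ n ≤ N, lam < bmoNorm (stepFun (fun k => SQ f k p) n)} with hE
  have hmono : Monotone E := by
    intro a b hab p hp
    obtain ⟨n, hn, h⟩ := hp
    exact ⟨n, hn.trans hab, h⟩
  have hsub : {p | lam < bmoSeq (fun n => SQ f n p)} ⊆ ⋃ N, E N := by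
    intro p hp
    obtain ⟨n, hn⟩ := exists_lt_of_lt_ciSup (show lam < ⨆ n : ℕ,
      bmoNorm (stepFun (fun k => SQ f k p) n) from hp)
    exact Set.mem_iUnion.2 ⟨n, n, le_rfl, hn⟩
  refine (measure_mono hsub).trans ?_
  rw [hmono.measure_iUnion]
  refine iSup_le fun N => ?_
  obtain ⟨Bad, _, hm, hb⟩ := final_N f hf hfl N (lam / 91202) (by positivity)
  refine (measure_mono ?_).trans hm
  intro p hp
  obtain ⟨n, hn, h⟩ := hp
  by_contra hpb
  have := hb p hpb n hn
  linarith


/-- Theorem 1, BMO-estimate: there is an absolute constant `c > 0`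
such that for every `f ∈ L log L(𝕋²)` and every `λ > 0`,
`|{(x,y) ∈ 𝕋² : bmo[S_{nn}(x,y,f)] > λ}| ≤ (c/λ)(1 + ∬_{𝕋²} |f| log⁺|f|)`. -/
theorem bmo_estimate_quadratic_partial_sums :
    ∃ c : ℝ, 0 < c ∧ ∀ f : ℝ × ℝ → ℝ, Measurable f → Biperiodic f →
      IntegrableOn f T2 → IntegrableOn (fun p => |f p| * logPlus |f p|) T2 →
      ∀ lam : ℝ, 0 < lam →
        volume {p : ℝ × ℝ | p ∈ T2 ∧ lam < bmoSeq (fun n => Snn f n p.1 p.2)} ≤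
          ENNReal.ofReal ((c / lam) * (1 + ∫ p in T2, |f p| * logPlus |f p|)) := by
  refine ⟨120 * 91202 * 16 * Real.pi ^ 2, by positivity, ?_⟩
  intro f hfm _ hf hfl lam hlam
  have hlogm : Measurable logPlus := by
    unfold logPlus
    exact Measurable.ite (measurableSet_lt measurable_const measurable_id) Real.measurable_log
      measurable_const
  have hFm := lft_measurable f hfm
  have hFlm : Measurable fun p => |lft f p| * logPlus |lft f p| := by
    have h1 : Measurable fun p => |lft f p| := hFm.abs
    exact h1.mul (hlogm.comp h1)
  have hF : Integrable (lft f) mu2 := by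
    apply integrable_transfer _ hFm
    exact hf.congr_fun (fun p hp => (lft_prj f p hp).symm) T2_meas
  have hFl : Integrable (fun p => |lft f p| * logPlus |lft f p|) mu2 := by
    apply integrable_transfer _ hFlm
    refine hfl.congr_fun (fun p hp => ?_) T2_meas
    simp only []
    rw [lft_prj f p hp]
  have hL : ∫ p in T2, |f p| * logPlus |f p| =
      4 * Real.pi ^ 2 * ∫ p, |lft f p| * logPlus |lft f p| ∂mu2 := by
    have h := int_transfer (fun p => |lft f p| * logPlus |lft f p|) hFlm.aestronglyMeasurable
    rw [smul_eq_mul] at h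
    rw [← h]
    apply setIntegral_congr_fun T2_meas
    intro p hp
    simp only []
    rw [lft_prj f p hp]
  set L := ∫ p, |lft f p| * logPlus |lft f p| ∂mu2 with hLdef
  have hL0 : 0 ≤ L := integral_nonneg fun p => mul_nonneg (abs_nonneg _) (logPlus_nonneg _)
  set S : Set (TT × TT) := {p | lam < bmoSeq (fun n => SQ (lft f) n p)} with hS
  have hmain := final_torus (lft f) hF hFl lam hlam
  have hsub : {p : ℝ × ℝ | p ∈ T2 ∧ lam < bmoSeq (fun n => Snn f n p.1 p.2)} ⊆
      prj ⁻¹' (toMeasurable mu2 S) ∩ T2 := by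
    intro p hp
    refine ⟨subset_toMeasurable _ _ ?_, hp.1⟩
    have h2 := hp.2
    simp only [Snn_transfer f hfm] at h2
    exact h2
  have hmeas : MeasurableSet (toMeasurable mu2 S) := measurableSet_toMeasurable _ _
  calc volume {p : ℝ × ℝ | p ∈ T2 ∧ lam < bmoSeq (fun n => Snn f n p.1 p.2)}
      ≤ volume (prj ⁻¹' (toMeasurable mu2 S) ∩ T2) := measure_mono hsub
    _ = (volume.restrict T2) (prj ⁻¹' (toMeasurable mu2 S)) := by
        rw [Measure.restrict_apply (prj_mp.measurable hmeas)]
    _ = ENNReal.ofReal (4 * Real.pi ^ 2) * mu2 S := by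
        rw [prj_mp.measure_preimage hmeas.nullMeasurableSet, vol_mu2, Measure.smul_apply,
          measure_toMeasurable, smul_eq_mul]
    _ ≤ ENNReal.ofReal (4 * Real.pi ^ 2) * ENNReal.ofReal (120 * (L + 4) / (lam / 91202)) := by
        gcongr
    _ ≤ _ := by
        rw [← ENNReal.ofReal_mul (by positivity)]
        apply ENNReal.ofReal_le_ofReal
        rw [hL]
        have hpi : 1 ≤ Real.pi ^ 2 := by nlinarith [Real.pi_gt_three]
        rw [show 4 * Real.pi ^ 2 * (120 * (L + 4) / (lam / 91202)) =
          (120 * 91202 * Real.pi ^ 2 / lam) * (4 * L + 16) by field_simp; ring]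
        rw [show 120 * 91202 * 16 * Real.pi ^ 2 / lam * (1 + 4 * Real.pi ^ 2 * L) =
          (120 * 91202 * Real.pi ^ 2 / lam) * (16 + 64 * (Real.pi ^ 2 * L)) by ring]
        have : 4 * L + 16 ≤ 16 + 64 * (Real.pi ^ 2 * L) := by nlinarith
        gcongr
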